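/- arXiv:2410.12364 — 3 statements merged into one kernel-verified Lean document; each statement's English description precedes it below -/
import Mathlib

section
/- (Guerra's upper bound.) Fix β ≥ 0, a Borel probability measure μ on [0,1], and a continuous function Φ : [0,1]×ℝ → ℝ having a bounded continuous partial derivative ∂_xΦ and continuous ∂_tΦ and ∂_x²Φ on (0,1)×ℝ minus the set of atoms of μ in the t-variable, satisfying Φ(1,x) = log cosh(x) for all x ∈ ℝ and −∂_tΦ(t,x) = β²(∂_x²Φ(t,x) + μ([0,t]) (∂_xΦ(t,x))²) for every (t,x) ∈ (0,1)×ℝ such that t is a continuity point of s ↦ μ([0,s]). Then for every N ≥ 1 one has F_N(β) ≤ Φ(0,0) − β² ∫₀¹ t μ([0,t]) dt + log 2. -/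
open MeasureTheory ProbabilityTheory Real Filter
open scoped NNReal

/-- The law of the i.i.d. standard Gaussian coefficients `(W_{ij})_{1 ≤ i,j ≤ N}`. -/
noncomputable def gaussW (N : ℕ) : Measure ((Fin N × Fin N) → ℝ) :=
  Measure.pi fun _ => gaussianReal 0 1

/-- The Sherrington–Kirkpatrick Hamiltonian. -/
noncomputable def HSK (N : ℕ) (W : (Fin N × Fin N) → ℝ) (σ : Fin N → ℝ) : ℝ :=
  (1 / Real.sqrt N) * ∑ i : Fin N, ∑ j : Fin N, W (i, j) * σ i * σ j

/-- The free energy of the SK model. -/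
noncomputable def FSK (N : ℕ) (β : ℝ) : ℝ :=
  (1 / N) * ∫ W, Real.log (∑ σ : Fin N → ({-1, 1} : Finset ℝ),
    Real.exp (β * HSK N W fun i => (σ i : ℝ))) ∂(gaussW N)

/-- The set of atoms of a measure `μ` on `ℝ`. -/
def atomSet (μ : Measure ℝ) : Set ℝ := {t : ℝ | μ {t} ≠ 0}

/-- `Φ : [0,1] × ℝ → ℝ` is an admissible solution of the Parisi PDE associated with the
Borel probability measure `μ` on `[0,1]` at inverse temperature `β`: it is continuous on
`[0,1] × ℝ`, has a bounded continuous partial derivative `∂ₓΦ`, has continuous `∂ₜΦ` and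
`∂ₓ²Φ` on `(0,1) × ℝ` minus the atoms of `μ` in the `t`-variable, satisfies the terminal
condition `Φ(1,x) = log cosh x`, and solves
`−∂ₜΦ = β² (∂ₓ²Φ + μ([0,t]) (∂ₓΦ)²)` at every `(t,x) ∈ (0,1) × ℝ` such that `t` is a
continuity point of `s ↦ μ([0,s])`. -/
def ParisiAdmissible (β : ℝ) (μ : Measure ℝ) (Φ : ℝ → ℝ → ℝ) : Prop :=
  ContinuousOn (fun p : ℝ × ℝ => Φ p.1 p.2) (Set.Icc 0 1 ×ˢ Set.univ) ∧
  (∀ x : ℝ, Φ 1 x = Real.log (Real.cosh x)) ∧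
  ∃ Φx Φt Φxx : ℝ → ℝ → ℝ, ∃ C : ℝ,
    (∀ t ∈ Set.Icc (0 : ℝ) 1, ∀ x : ℝ, HasDerivAt (fun y => Φ t y) (Φx t x) x) ∧
    ContinuousOn (fun p : ℝ × ℝ => Φx p.1 p.2) (Set.Icc 0 1 ×ˢ Set.univ) ∧
    (∀ t ∈ Set.Icc (0 : ℝ) 1, ∀ x : ℝ, |Φx t x| ≤ C) ∧
    (∀ p : ℝ × ℝ, p ∈ (Set.Ioo (0 : ℝ) 1 \ atomSet μ) ×ˢ (Set.univ : Set ℝ) →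
      HasDerivAt (fun s => Φ s p.2) (Φt p.1 p.2) p.1 ∧
      HasDerivAt (fun y => Φx p.1 y) (Φxx p.1 p.2) p.2) ∧
    ContinuousOn (fun p : ℝ × ℝ => Φt p.1 p.2)
      ((Set.Ioo (0 : ℝ) 1 \ atomSet μ) ×ˢ Set.univ) ∧
    ContinuousOn (fun p : ℝ × ℝ => Φxx p.1 p.2)
      ((Set.Ioo (0 : ℝ) 1 \ atomSet μ) ×ˢ Set.univ) ∧
    (∀ t ∈ Set.Ioo (0 : ℝ) 1,
      ContinuousAt (fun s : ℝ => (μ (Set.Icc 0 s)).toReal) t →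
      ∀ x : ℝ,
        -Φt t x = β ^ 2 * (Φxx t x + (μ (Set.Icc 0 t)).toReal * (Φx t x) ^ 2))

/-! ### Gaussian integrals of functions of exponential growth -/

theorem integrable_abs_pow_mul_exp_abs_gaussian (p : ℕ) (c : ℝ) :
    Integrable (fun g : ℝ => |g| ^ p * exp (c * |g|)) (gaussianReal 0 1) := by
  have h1 : Integrable (fun g : ℝ => (p.factorial : ℝ) * (exp ((|c| + 1) * g)
      + exp (-(|c| + 1) * g))) (gaussianReal 0 1) :=
    ((integrable_exp_mul_gaussianReal _).add (integrable_exp_mul_gaussianReal _)).const_mul _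
  refine h1.mono' (by fun_prop) (ae_of_all _ fun g => ?_)
  have h2 : |g| ^ p ≤ p.factorial * exp |g| := by
    have := Real.pow_div_factorial_le_exp (|g|) (abs_nonneg g) p
    rwa [div_le_iff₀ (by positivity), mul_comm] at this
  have h3 : exp (c * |g|) ≤ exp (|c| * |g|) :=
    exp_le_exp.2 (mul_le_mul_of_nonneg_right (le_abs_self c) (abs_nonneg g))
  have h4 : exp ((|c| + 1) * |g|) ≤ exp ((|c| + 1) * g) + exp (-(|c| + 1) * g) := by
    rcases abs_choice g with h | h <;> rw [h]
    · linarith [exp_pos (-(|c| + 1) * g)]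
    · rw [mul_neg, ← neg_mul]; linarith [exp_pos ((|c| + 1) * g)]
  rw [norm_of_nonneg (by positivity)]
  calc |g| ^ p * exp (c * |g|) ≤ (p.factorial * exp |g|) * exp (|c| * |g|) := by gcongr
    _ = p.factorial * exp ((|c| + 1) * |g|) := by rw [mul_assoc, ← exp_add]; ring_nf
    _ ≤ _ := by gcongr

/-- Gaussian integration by parts. -/
theorem integral_mul_gaussian_eq {f f' : ℝ → ℝ} (hf : ∀ x, HasDerivAt f (f' x) x)
    (hf' : Continuous f') {C : ℝ} (hC : ∀ x, |f x| ≤ C * exp (C * |x|))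
    (hC' : ∀ x, |f' x| ≤ C * exp (C * |x|)) :
    ∫ g, g * f g ∂(gaussianReal 0 1) = ∫ g, f' g ∂(gaussianReal 0 1) := by
  have hfc : Continuous f := continuous_iff_continuousAt.2 fun x => (hf x).continuousAt
  have hpdf : ∀ x, HasDerivAt (gaussianPDFReal 0 1) (-x * gaussianPDFReal 0 1 x) x := by
    intro x
    have h1 : HasDerivAt (fun x : ℝ => -(x - 0) ^ 2 / (2 * ((1 : ℝ≥0) : ℝ))) (-x) x := by
      have := (((hasDerivAt_id x).sub_const 0).pow 2).neg.div_const (2 * ((1 : ℝ≥0) : ℝ))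
      refine this.congr_deriv ?_
      simp; ring
    have h2 := h1.exp.const_mul (√(2 * π * ((1 : ℝ≥0) : ℝ)))⁻¹
    have h3 : gaussianPDFReal 0 1 = fun x : ℝ => (√(2 * π * ((1 : ℝ≥0) : ℝ)))⁻¹ *
      rexp (-(x - 0) ^ 2 / (2 * ((1 : ℝ≥0) : ℝ))) := gaussianPDFReal_def 0 1
    rw [h3]
    exact h2.congr_deriv (by ring)
  have hint : ∀ u : ℝ → ℝ, Integrable u (gaussianReal 0 1) →
      Integrable (fun x => u x * gaussianPDFReal 0 1 x) := by
    intro u hu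
    rw [gaussianReal_of_var_ne_zero 0 one_ne_zero,
      integrable_withDensity_iff_integrable_smul' (measurable_gaussianPDF 0 1)
        (ae_of_all _ fun x => gaussianPDF_lt_top)] at hu
    refine hu.congr (ae_of_all _ fun x => ?_)
    simp [toReal_gaussianPDF, mul_comm]
  have i0 : Integrable f (gaussianReal 0 1) := by
    refine ((integrable_abs_pow_mul_exp_abs_gaussian 0 C).const_mul C).mono'
      hfc.aestronglyMeasurable (ae_of_all _ fun x => ?_)
    simpa using hC x
  have i1 : Integrable f' (gaussianReal 0 1) := by
    refine ((integrable_abs_pow_mul_exp_abs_gaussian 0 C).const_mul C).mono'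
      hf'.aestronglyMeasurable (ae_of_all _ fun x => ?_)
    simpa using hC' x
  have i2 : Integrable (fun x => x * f x) (gaussianReal 0 1) := by
    refine ((integrable_abs_pow_mul_exp_abs_gaussian 1 C).const_mul C).mono'
      (by fun_prop) (ae_of_all _ fun x => ?_)
    rw [norm_mul, pow_one]
    calc ‖x‖ * ‖f x‖ ≤ |x| * (C * exp (C * |x|)) := by
          gcongr
          · exact le_of_eq (norm_eq_abs x)
          · exact hC x
      _ = _ := by ring
  have key := integral_mul_deriv_eq_deriv_mul_of_integrable (u := f) (u' := f')
    (v := gaussianPDFReal 0 1) (v' := fun x => -x * gaussianPDFReal 0 1 x)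
    (fun x _ => hf x) (fun x _ => hpdf x)
    ((hint _ i2).neg.congr (ae_of_all _ fun x => by simp; ring)) (hint _ i1) (hint _ i0)
  rw [integral_gaussianReal_eq_integral_smul one_ne_zero,
    integral_gaussianReal_eq_integral_smul one_ne_zero]
  simp only [smul_eq_mul]
  have e1 : ∫ x, gaussianPDFReal 0 1 x * (x * f x) =
      -∫ x, f x * (-x * gaussianPDFReal 0 1 x) := by
    rw [← integral_neg]; congr 1; ext x; ring
  rw [e1, key, neg_neg]
  congr 1; ext x; ring

section Growth

set_option linter.unusedSectionVars false

variable {E : Type} [NormedAddCommGroup E] [NormedSpace ℝ E]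

/-- Exponential growth in the first variable, locally uniformly in the amplitudes. -/
def ExpBdd {G : Type} [NormedAddCommGroup G] (f : E × ℝ × ℝ → G) : Prop :=
  ∀ R : ℝ, ∃ C : ℝ, 0 ≤ C ∧ ∀ X : E × ℝ × ℝ, ‖X.2‖ ≤ R → ‖f X‖ ≤ C * exp (C * ‖X.1‖)

/-- `n` times differentiable, with a continuous `n`-th derivative and all derivatives of
exponential growth. -/
def ExpReg : ℕ → ∀ {G : Type} [NormedAddCommGroup G] [NormedSpace ℝ G], (E × ℝ × ℝ → G) → Prop
  | 0, _, _, _, f => Continuous f ∧ ExpBdd f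
  | n + 1, _, _, _, f => ExpBdd f ∧ ∃ f' : E × ℝ × ℝ → E × ℝ × ℝ →L[ℝ] _,
      (∀ X, HasFDerivAt f (f' X) X) ∧ ExpReg n f'

variable {G : Type} [NormedAddCommGroup G] [NormedSpace ℝ G]
  {G₁ : Type} [NormedAddCommGroup G₁] [NormedSpace ℝ G₁]
  {G₂ : Type} [NormedAddCommGroup G₂] [NormedSpace ℝ G₂]

theorem ExpBdd.of_le {f : E × ℝ × ℝ → G} (h : ∀ R : ℝ, ∃ C D : ℝ, ∀ X : E × ℝ × ℝ,
    ‖X.2‖ ≤ R → ‖f X‖ ≤ C * exp (D * ‖X.1‖)) : ExpBdd f := by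
  intro R
  obtain ⟨C, D, hCD⟩ := h R
  refine ⟨max (max C D) 0, le_max_right _ _, fun X hX => (hCD X hX).trans ?_⟩
  have h1 : C ≤ max (max C D) 0 := (le_max_left C D).trans (le_max_left _ _)
  have h2 : D ≤ max (max C D) 0 := (le_max_right C D).trans (le_max_left _ _)
  gcongr

theorem ExpReg.expBdd {n : ℕ} {f : E × ℝ × ℝ → G} (h : ExpReg n f) : ExpBdd f := by
  cases n with
  | zero => exact h.2
  | succ n => exact h.1

theorem ExpReg.continuous {n : ℕ} {f : E × ℝ × ℝ → G} (h : ExpReg n f) : Continuous f := by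
  cases n with
  | zero => exact h.1
  | succ n =>
    obtain ⟨-, f', hf, -⟩ := h
    exact continuous_iff_continuousAt.2 fun X => (hf X).continuousAt

theorem ExpReg.hasFDerivAt {n : ℕ} {f : E × ℝ × ℝ → G} (h : ExpReg (n + 1) f)
    (X : E × ℝ × ℝ) : HasFDerivAt f (fderiv ℝ f X) X := by
  obtain ⟨-, f', hf, -⟩ := h
  exact (hf X).differentiableAt.hasFDerivAt

theorem ExpReg.fderiv_reg {n : ℕ} {f : E × ℝ × ℝ → G} (h : ExpReg (n + 1) f) :
    ExpReg n (fderiv ℝ f) := by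
  obtain ⟨-, f', hf, hf'⟩ := h
  have : fderiv ℝ f = f' := funext fun X => (hf X).fderiv
  rwa [this]

theorem ExpReg.of_succ {n : ℕ} : ∀ {G : Type} [NormedAddCommGroup G] [NormedSpace ℝ G]
    {f : E × ℝ × ℝ → G}, ExpReg (n + 1) f → ExpReg n f := by
  induction n with
  | zero => exact fun h => ⟨h.continuous, h.expBdd⟩
  | succ n ih =>
    intro G _ _ f h
    obtain ⟨hb, f', hf, hf'⟩ := h
    exact ⟨hb, f', hf, ih hf'⟩

theorem ExpBdd.clm {f : E × ℝ × ℝ → G₁} (h : ExpBdd f) (A : G₁ →L[ℝ] G) :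
    ExpBdd fun X => A (f X) := by
  refine ExpBdd.of_le fun R => ?_
  obtain ⟨C, hC, hb⟩ := h R
  refine ⟨‖A‖ * C, C, fun X hX => (A.le_opNorm _).trans ?_⟩
  rw [mul_assoc]
  exact mul_le_mul_of_nonneg_left (hb X hX) (norm_nonneg _)

theorem ExpReg.clm {n : ℕ} : ∀ {G₁ G : Type} [NormedAddCommGroup G₁] [NormedSpace ℝ G₁]
    [NormedAddCommGroup G] [NormedSpace ℝ G] {f : E × ℝ × ℝ → G₁} (_ : ExpReg n f)
    (A : G₁ →L[ℝ] G), ExpReg n fun X => A (f X) := by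
  induction n with
  | zero =>
    intro G₁ G _ _ _ _ f h A
    exact ⟨A.continuous.comp h.1, h.2.clm A⟩
  | succ n ih =>
    intro G₁ G _ _ _ _ f h A
    obtain ⟨hb, f', hf, hf'⟩ := h
    exact ⟨hb.clm A, fun X => A.comp (f' X), fun X => A.hasFDerivAt.comp X (hf X),
      ih hf' (ContinuousLinearMap.compL ℝ (E × ℝ × ℝ) G₁ G A)⟩

theorem ExpBdd.add {f g : E × ℝ × ℝ → G} (hf : ExpBdd f) (hg : ExpBdd g) :
    ExpBdd fun X => f X + g X := by
  refine ExpBdd.of_le fun R => ?_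
  obtain ⟨C, hC, hb⟩ := hf R
  obtain ⟨D, hD, hb'⟩ := hg R
  refine ⟨C + D, C + D, fun X hX => (norm_add_le _ _).trans ?_⟩
  rw [add_mul]
  refine add_le_add ((hb X hX).trans ?_) ((hb' X hX).trans ?_) <;> gcongr <;> linarith

theorem ExpReg.add {n : ℕ} : ∀ {G : Type} [NormedAddCommGroup G] [NormedSpace ℝ G]
    {f g : E × ℝ × ℝ → G} (_ : ExpReg n f) (_ : ExpReg n g), ExpReg n fun X => f X + g X := by
  induction n with
  | zero => exact fun h h' => ⟨h.1.add h'.1, h.2.add h'.2⟩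
  | succ n ih =>
    intro G _ _ f g hf hg
    obtain ⟨hb, f', hf, hf'⟩ := hf
    obtain ⟨gb, g', hg, hg'⟩ := hg
    exact ⟨hb.add gb, _, fun X => (hf X).add (hg X), ih hf' hg'⟩

theorem ExpBdd.bilin {f : E × ℝ × ℝ → G₁} {g : E × ℝ × ℝ → G₂} (hf : ExpBdd f) (hg : ExpBdd g)
    (B : G₁ →L[ℝ] G₂ →L[ℝ] G) : ExpBdd fun X => B (f X) (g X) := by
  refine ExpBdd.of_le fun R => ?_
  obtain ⟨C, hC, hb⟩ := hf R
  obtain ⟨D, hD, hb'⟩ := hg R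
  refine ⟨‖B‖ * C * D, C + D, fun X hX => (B.le_opNorm₂ _ _).trans ?_⟩
  calc ‖B‖ * ‖f X‖ * ‖g X‖ ≤ ‖B‖ * (C * exp (C * ‖X.1‖)) * (D * exp (D * ‖X.1‖)) := by
        gcongr
        · exact hb X hX
        · exact hb' X hX
    _ = _ := by rw [add_mul, exp_add]; ring

theorem ExpReg.bilin {n : ℕ} : ∀ {G₁ G₂ G : Type} [NormedAddCommGroup G₁] [NormedSpace ℝ G₁]
    [NormedAddCommGroup G₂] [NormedSpace ℝ G₂] [NormedAddCommGroup G] [NormedSpace ℝ G]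
    {f : E × ℝ × ℝ → G₁} {g : E × ℝ × ℝ → G₂} (_ : ExpReg n f) (_ : ExpReg n g)
    (B : G₁ →L[ℝ] G₂ →L[ℝ] G), ExpReg n fun X => B (f X) (g X) := by
  induction n with
  | zero =>
    intro G₁ G₂ G _ _ _ _ _ _ f g hf hg B
    exact ⟨B.continuous₂.comp (hf.1.prodMk hg.1), hf.2.bilin hg.2 B⟩
  | succ n ih =>
    intro G₁ G₂ G _ _ _ _ _ _ f g hf hg B
    have hf0 := hf.of_succ
    have hg0 := hg.of_succ
    obtain ⟨hb, f', hf, hf'⟩ := hf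
    obtain ⟨gb, g', hg, hg'⟩ := hg
    exact ⟨hb.bilin gb B, _, fun X => B.hasFDerivAt_of_bilinear (hf X) (hg X),
      (ih hf0 hg' (B.precompR (E × ℝ × ℝ))).add (ih hf' hg0 (B.precompL (E × ℝ × ℝ)))⟩

/-- Freezing the amplitudes preserves regularity. -/
theorem ExpReg.freeze {n : ℕ} (a : ℝ × ℝ) : ∀ {G : Type} [NormedAddCommGroup G]
    [NormedSpace ℝ G] {f : E × ℝ × ℝ → G}, ExpReg n f →
    ExpReg n fun X : E × ℝ × ℝ => f (X.1, a) := by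
  have hb : ∀ {G : Type} [NormedAddCommGroup G] {f : E × ℝ × ℝ → G}, ExpBdd f →
      ExpBdd fun X : E × ℝ × ℝ => f (X.1, a) := by
    intro G _ f h R
    obtain ⟨C, hC, hb⟩ := h ‖a‖
    exact ⟨C, hC, fun X _ => hb (X.1, a) le_rfl⟩
  induction n with
  | zero =>
    intro G _ _ f h
    exact ⟨h.1.comp (by fun_prop), hb h.2⟩
  | succ n ih =>
    intro G _ _ f h
    obtain ⟨hbf, f', hf, hf'⟩ := h
    set A : E × ℝ × ℝ →L[ℝ] E × ℝ × ℝ :=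
      (ContinuousLinearMap.inl ℝ E (ℝ × ℝ)).comp (ContinuousLinearMap.fst ℝ E (ℝ × ℝ))
    have hA : ∀ X, HasFDerivAt (fun X : E × ℝ × ℝ => (X.1, a)) A X := by
      intro X
      have : (fun X : E × ℝ × ℝ => (X.1, a)) = fun X => A X + (0, a) := by
        ext X <;> simp [A]
      rw [this]
      exact A.hasFDerivAt.add_const _
    exact ⟨hb hbf, fun X => (f' (X.1, a)).comp A, fun X => (hf (X.1, a)).comp X (hA X),
      (ih hf').clm ((ContinuousLinearMap.compL ℝ (E × ℝ × ℝ) (E × ℝ × ℝ) G).flip A)⟩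

theorem ExpBdd.exp_clm (ℓ : E →L[ℝ] ℝ) : ExpBdd fun X : E × ℝ × ℝ => exp (ℓ X.1) := by
  refine ExpBdd.of_le fun R => ⟨1, ‖ℓ‖, fun X _ => ?_⟩
  rw [one_mul, norm_of_nonneg (exp_pos _).le]
  exact exp_le_exp.2 ((le_abs_self _).trans (ℓ.le_opNorm _))

theorem ExpReg.exp_clm {n : ℕ} (ℓ : E →L[ℝ] ℝ) :
    ExpReg n fun X : E × ℝ × ℝ => exp (ℓ X.1) := by
  induction n with
  | zero => exact ⟨by fun_prop, ExpBdd.exp_clm ℓ⟩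
  | succ n ih =>
    refine ⟨ExpBdd.exp_clm ℓ, fun X => exp (ℓ X.1) •
      ℓ.comp (ContinuousLinearMap.fst ℝ E (ℝ × ℝ)), fun X => ?_, ?_⟩
    · exact (ℓ.comp (ContinuousLinearMap.fst ℝ E (ℝ × ℝ))).hasFDerivAt.exp
    · exact ih.clm (ContinuousLinearMap.toSpanSingleton ℝ _)

theorem ExpReg.sum {n : ℕ} {ι : Type} (s : Finset ι) (hs : s.Nonempty) {f : ι → E × ℝ × ℝ → G}
    (h : ∀ i ∈ s, ExpReg n (f i)) : ExpReg n fun X => ∑ i ∈ s, f i X := by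
  classical
  induction hs using Finset.Nonempty.cons_induction with
  | singleton i => simpa using h i (by simp)
  | cons i s hi hs ih =>
    simp only [Finset.sum_cons]
    exact (h i (by simp)).add (ih fun j hj => h j (by simp [hj]))

theorem ExpBdd.rpow {h : E × ℝ × ℝ → ℝ} (hpos : ∀ X, 0 < h X) (hb : ExpBdd h)
    (hi : ExpBdd fun X => (h X)⁻¹) (θ : ℝ) : ExpBdd fun X => h X ^ θ := by
  have key : ∀ {f : E × ℝ × ℝ → ℝ}, (∀ X, 0 < f X) → ExpBdd f → ∀ θ : ℝ, 0 ≤ θ →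
      ExpBdd fun X => f X ^ θ := by
    intro f fpos fb θ hθ
    refine ExpBdd.of_le fun R => ?_
    obtain ⟨C, hC, hb⟩ := fb R
    refine ⟨C ^ θ, C * θ, fun X hX => ?_⟩
    have h1 := hb X hX
    rw [norm_of_nonneg (fpos X).le] at h1
    rw [norm_of_nonneg (rpow_nonneg (fpos X).le _)]
    calc f X ^ θ ≤ (C * exp (C * ‖X.1‖)) ^ θ := rpow_le_rpow (fpos X).le h1 hθ
      _ = _ := by
        rw [mul_rpow hC (exp_pos _).le, ← exp_mul]; ring_nf
  rcases le_total 0 θ with hθ | hθ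
  · exact key hpos hb θ hθ
  · have := key (fun X => inv_pos.2 (hpos X)) hi (-θ) (by linarith)
    convert this using 2 with X
    rw [inv_rpow (hpos X).le, rpow_neg (hpos X).le, inv_inv]

theorem ExpReg.rpow {n : ℕ} {h : E × ℝ × ℝ → ℝ} (hpos : ∀ X, 0 < h X) (hr : ExpReg n h)
    (hi : ExpBdd fun X => (h X)⁻¹) (θ : ℝ) : ExpReg n fun X => h X ^ θ := by
  induction n generalizing θ with
  | zero =>
    exact ⟨hr.1.rpow_const fun X => Or.inl (hpos X).ne', hr.2.rpow hpos hi θ⟩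
  | succ n ih =>
    have h0 := hr.of_succ
    obtain ⟨hb, h', hd, hr'⟩ := hr
    refine ⟨hb.rpow hpos hi θ, fun X => (θ * h X ^ (θ - 1)) • h' X, fun X => ?_, ?_⟩
    · exact (hd X).rpow_const (Or.inl (hpos X).ne')
    · exact ((ih h0 (θ - 1)).clm (θ • ContinuousLinearMap.id ℝ ℝ)).bilin hr'
        (ContinuousLinearMap.lsmul ℝ ℝ)

/-- The shift direction `X ↦ (ℓ(X₂) w, 0)`. -/
noncomputable def shiftDir (ℓ : ℝ × ℝ →L[ℝ] ℝ) (w : E) : E × ℝ × ℝ →L[ℝ] E × ℝ × ℝ :=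
  (ContinuousLinearMap.inl ℝ E (ℝ × ℝ)).comp
    ((ℓ.comp (ContinuousLinearMap.snd ℝ E (ℝ × ℝ))).smulRight w)

@[simp] theorem shiftDir_apply (ℓ : ℝ × ℝ →L[ℝ] ℝ) (w : E) (X : E × ℝ × ℝ) :
    shiftDir ℓ w X = (ℓ X.2 • w, 0) := rfl

theorem ExpBdd.shift {f : E × ℝ × ℝ → G} (h : ExpBdd f) (ℓ : ℝ × ℝ →L[ℝ] ℝ) (w : E) (R : ℝ) :
    ∃ C, 0 ≤ C ∧ ∀ (X : E × ℝ × ℝ) (g : ℝ), ‖X.2‖ ≤ R →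
      ‖f (X + g • shiftDir ℓ w X)‖ ≤ C * exp (C * ‖X.1‖) * exp (C * |g|) := by
  obtain ⟨C, hC, hb⟩ := h R
  set D := ‖ℓ‖ * |R| * ‖w‖
  have hD : 0 ≤ D := by positivity
  refine ⟨C * (1 + D), by positivity, fun X g hX => ?_⟩
  have h1 : ‖(X + g • shiftDir ℓ w X).1‖ ≤ ‖X.1‖ + D * |g| := by
    simp only [shiftDir_apply, Prod.fst_add, Prod.smul_fst]
    refine (norm_add_le _ _).trans ?_
    gcongr
    rw [norm_smul, norm_smul]
    calc ‖g‖ * (‖ℓ X.2‖ * ‖w‖) ≤ ‖g‖ * ((‖ℓ‖ * |R|) * ‖w‖) := by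
          gcongr
          exact (ℓ.le_opNorm _).trans (by gcongr; exact hX.trans (le_abs_self R))
      _ = D * |g| := by simp only [D, norm_eq_abs]; ring
  have h2 : ‖(X + g • shiftDir ℓ w X).2‖ ≤ R := by simpa using hX
  refine (hb _ h2).trans ?_
  rw [mul_assoc, ← exp_add]
  have h3 : C * ‖(X + g • shiftDir ℓ w X).1‖ ≤ C * (1 + D) * ‖X.1‖ + C * (1 + D) * |g| := by
    calc _ ≤ C * (‖X.1‖ + D * |g|) := by gcongr
      _ ≤ _ := by nlinarith [mul_nonneg (mul_nonneg hC hD) (norm_nonneg X.1),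
                  mul_nonneg hC (abs_nonneg g)]
  have h4 : C ≤ C * (1 + D) := by nlinarith [mul_nonneg hC hD]
  gcongr

/-- Gaussian moments along the shift direction. -/
noncomputable def gaussMom (p : ℕ) (L : E × ℝ × ℝ →L[ℝ] E × ℝ × ℝ) (k : E × ℝ × ℝ → G)
    (X : E × ℝ × ℝ) : G :=
  ∫ g : ℝ, g ^ p • k (X + g • L X) ∂(gaussianReal 0 1)

theorem integrable_gaussMom {k : E × ℝ × ℝ → G} (hc : Continuous k) (hb : ExpBdd k) (p : ℕ)
    (ℓ : ℝ × ℝ →L[ℝ] ℝ) (w : E) (X : E × ℝ × ℝ) :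
    Integrable (fun g : ℝ => g ^ p • k (X + g • shiftDir ℓ w X)) (gaussianReal 0 1) := by
  obtain ⟨C, hC, h⟩ := hb.shift ℓ w ‖X.2‖
  refine ((integrable_abs_pow_mul_exp_abs_gaussian p C).const_mul (C * exp (C * ‖X.1‖))).mono'
    (by fun_prop) (ae_of_all _ fun g => ?_)
  rw [norm_smul, norm_pow, norm_eq_abs]
  calc |g| ^ p * _ ≤ |g| ^ p * (C * exp (C * ‖X.1‖) * exp (C * |g|)) := by
        gcongr; exact h X g le_rfl
    _ = _ := by ring

theorem ExpBdd.gaussMom {k : E × ℝ × ℝ → G} (hb : ExpBdd k) (p : ℕ)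
    (ℓ : ℝ × ℝ →L[ℝ] ℝ) (w : E) : ExpBdd (gaussMom p (shiftDir ℓ w) k) := by
  refine ExpBdd.of_le fun R => ?_
  obtain ⟨C, hC, h⟩ := hb.shift ℓ w R
  refine ⟨C * ∫ g, |g| ^ p * exp (C * |g|) ∂(gaussianReal 0 1), C, fun X hX => ?_⟩
  calc ‖_root_.gaussMom p (shiftDir ℓ w) k X‖
      ≤ ∫ g, (C * exp (C * ‖X.1‖)) * (|g| ^ p * exp (C * |g|)) ∂(gaussianReal 0 1) := by
        refine norm_integral_le_of_norm_le
          ((integrable_abs_pow_mul_exp_abs_gaussian p C).const_mul _) (ae_of_all _ fun g => ?_)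
        rw [norm_smul, norm_pow, norm_eq_abs]
        calc |g| ^ p * _ ≤ |g| ^ p * (C * exp (C * ‖X.1‖) * exp (C * |g|)) := by
              gcongr; exact h X g hX
          _ = _ := by ring
    _ = _ := by rw [integral_const_mul]; ring

theorem shift_bound {f : E × ℝ × ℝ → G} (h : ExpBdd f) (p : ℕ) (ℓ : ℝ × ℝ →L[ℝ] ℝ) (w : E)
    (X₀ : E × ℝ × ℝ) : ∃ C D : ℝ, 0 ≤ C ∧ ∀ X ∈ Metric.ball X₀ 1, ∀ g : ℝ,
      ‖g ^ p • f (X + g • shiftDir ℓ w X)‖ ≤ D * (|g| ^ p * exp (C * |g|)) := by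
  obtain ⟨C, hC, h⟩ := h.shift ℓ w (‖X₀‖ + 1)
  refine ⟨C, C * exp (C * (‖X₀‖ + 1)), hC, fun X hX g => ?_⟩
  have hX' : ‖X‖ ≤ ‖X₀‖ + 1 := by
    have h1 : ‖X - X₀‖ < 1 := by rwa [mem_ball_iff_norm] at hX
    have h2 := norm_le_norm_add_norm_sub' X X₀
    linarith
  have h1 := h X g ((norm_snd_le X).trans hX')
  have h2 : ‖X.1‖ ≤ ‖X₀‖ + 1 := (norm_fst_le X).trans hX'
  rw [norm_smul, norm_pow, norm_eq_abs]
  calc |g| ^ p * _ ≤ |g| ^ p * (C * exp (C * ‖X.1‖) * exp (C * |g|)) := by gcongr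
    _ ≤ |g| ^ p * (C * exp (C * (‖X₀‖ + 1)) * exp (C * |g|)) := by gcongr
    _ = _ := by ring

theorem continuous_gaussMom {k : E × ℝ × ℝ → G} (hc : Continuous k) (hb : ExpBdd k) (p : ℕ)
    (ℓ : ℝ × ℝ →L[ℝ] ℝ) (w : E) : Continuous (gaussMom p (shiftDir ℓ w) k) := by
  refine continuous_iff_continuousAt.2 fun X₀ => ?_
  obtain ⟨C, D, hC, h⟩ := shift_bound hb p ℓ w X₀
  refine continuousAt_of_dominated (bound := fun g => D * (|g| ^ p * exp (C * |g|)))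
    (Eventually.of_forall fun X => by fun_prop) ?_
    ((integrable_abs_pow_mul_exp_abs_gaussian p C).const_mul _)
    (ae_of_all _ fun g => by fun_prop)
  filter_upwards [Metric.ball_mem_nhds X₀ one_pos] with X hX
  exact ae_of_all _ fun g => h X hX g

theorem hasFDerivAt_gaussMom [CompleteSpace G] {k : E × ℝ × ℝ → G} (hk : ExpReg 1 k) (p : ℕ)
    (ℓ : ℝ × ℝ →L[ℝ] ℝ) (w : E) (X : E × ℝ × ℝ) :
    HasFDerivAt (gaussMom p (shiftDir ℓ w) k)
      (gaussMom p (shiftDir ℓ w) (fderiv ℝ k) X +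
        (gaussMom (p + 1) (shiftDir ℓ w) (fderiv ℝ k) X).comp (shiftDir ℓ w)) X := by
  set L := shiftDir ℓ w
  have hk' := hk.fderiv_reg
  have i0 := integrable_gaussMom hk'.1 hk'.2 p ℓ w X
  have i1 := integrable_gaussMom hk'.1 hk'.2 (p + 1) ℓ w X
  obtain ⟨C, D, hC, hb⟩ := shift_bound hk'.2 p ℓ w X
  obtain ⟨C', D', hC', hb'⟩ := shift_bound hk'.2 (p + 1) ℓ w X
  set A := (ContinuousLinearMap.compL ℝ (E × ℝ × ℝ) (E × ℝ × ℝ) G).flip L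
  have hA : ∀ T : E × ℝ × ℝ →L[ℝ] G, T.comp L = A T := fun T => rfl
  have e : gaussMom p L (fderiv ℝ k) X + (gaussMom (p + 1) L (fderiv ℝ k) X).comp L =
      ∫ g : ℝ, (g ^ p • fderiv ℝ k (X + g • L X) +
        A (g ^ (p + 1) • fderiv ℝ k (X + g • L X))) ∂(gaussianReal 0 1) := by
    rw [integral_add i0 (A.integrable_comp i1), A.integral_comp_comm i1, hA]
    rfl
  rw [e]
  refine hasFDerivAt_integral_of_dominated_of_fderiv_le
    (F' := fun X g => g ^ p • fderiv ℝ k (X + g • L X) +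
        A (g ^ (p + 1) • fderiv ℝ k (X + g • L X)))
    (bound := fun g => D * (|g| ^ p * exp (C * |g|)) +
      ‖A‖ * (D' * (|g| ^ (p + 1) * exp (C' * |g|))))
    (Metric.ball_mem_nhds X one_pos)
    (Eventually.of_forall fun Y => ?_) (integrable_gaussMom hk.continuous hk.expBdd p ℓ w X)
    ?_ (ae_of_all _ fun g Y hY => ?_) ?_ (ae_of_all _ fun g Y _ => ?_)
  · have := hk.continuous
    exact Continuous.aestronglyMeasurable (by fun_prop)
  · have := hk'.1
    exact Continuous.aestronglyMeasurable (by fun_prop)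
  · refine (norm_add_le _ _).trans (add_le_add (hb Y hY g) ((A.le_opNorm _).trans ?_))
    exact mul_le_mul_of_nonneg_left (hb' Y hY g) (norm_nonneg _)
  · exact ((integrable_abs_pow_mul_exp_abs_gaussian p C).const_mul _).add
      (((integrable_abs_pow_mul_exp_abs_gaussian (p + 1) C').const_mul _).const_mul _)
  · have h1 : HasFDerivAt (fun Y : E × ℝ × ℝ => Y + g • L Y)
        (ContinuousLinearMap.id ℝ _ + g • L) Y :=
      (hasFDerivAt_id Y).add (L.hasFDerivAt.const_smul g)
    have h2 := ((hk.hasFDerivAt (Y + g • L Y)).comp Y h1).const_smul (g ^ p)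
    refine h2.congr_fderiv ?_
    refine ContinuousLinearMap.ext fun u => ?_
    simp [A, pow_succ, mul_smul, smul_add]

theorem ExpReg.gaussMom {n : ℕ} (ℓ : ℝ × ℝ →L[ℝ] ℝ) (w : E) : ∀ {G : Type}
    [NormedAddCommGroup G] [NormedSpace ℝ G] [CompleteSpace G] {k : E × ℝ × ℝ → G}
    (_ : ExpReg n k) (p : ℕ),
    ExpReg n (gaussMom p (shiftDir ℓ w) k) := by
  induction n with
  | zero =>
    intro G _ _ _ k hk p
    exact ⟨continuous_gaussMom hk.1 hk.2 p ℓ w, hk.2.gaussMom p ℓ w⟩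
  | succ n ih =>
    intro G _ _ _ k hk p
    have hk1 : ExpReg 1 k := by
      refine ⟨hk.expBdd, _, hk.hasFDerivAt, hk.fderiv_reg.continuous, hk.fderiv_reg.expBdd⟩
    exact ⟨hk.expBdd.gaussMom p ℓ w, _, hasFDerivAt_gaussMom hk1 p ℓ w,
      (ih hk.fderiv_reg p).add ((ih hk.fderiv_reg (p + 1)).clm
        ((ContinuousLinearMap.compL ℝ (E × ℝ × ℝ) (E × ℝ × ℝ) G).flip (shiftDir ℓ w)))⟩

end Growth

section Flow

variable {E : Type} [NormedAddCommGroup E] [NormedSpace ℝ E]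

/-- Positive functions, twice differentiable, such that they, their inverses and their derivatives
have exponential growth. -/
structure PosReg (h : E × ℝ × ℝ → ℝ) : Prop where
  pos : ∀ X, 0 < h X
  inv : ExpBdd fun X => (h X)⁻¹
  reg : ExpReg 2 h

theorem PosReg.rpow {h : E × ℝ × ℝ → ℝ} (hh : PosReg h) (θ : ℝ) : PosReg fun X => h X ^ θ where
  pos X := rpow_pos_of_pos (hh.pos X) θ
  inv := by
    have := hh.reg.expBdd.rpow hh.pos hh.inv (-θ)
    convert this using 2 with X
    rw [rpow_neg (hh.pos X).le]
  reg := hh.reg.rpow hh.pos hh.inv θ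

theorem PosReg.freeze {h : E × ℝ × ℝ → ℝ} (hh : PosReg h) (a : ℝ × ℝ) :
    PosReg fun X : E × ℝ × ℝ => h (X.1, a) where
  pos X := hh.pos _
  inv R := by
    obtain ⟨C, hC, hb⟩ := hh.inv ‖a‖
    exact ⟨C, hC, fun X _ => hb (X.1, a) le_rfl⟩
  reg := hh.reg.freeze a

theorem PosReg.sum_exp {ι : Type} [Fintype ι] [Nonempty ι] (ℓ : ι → E →L[ℝ] ℝ) :
    PosReg fun X : E × ℝ × ℝ => ∑ i, exp (ℓ i X.1) where
  pos X := Finset.sum_pos (fun i _ => exp_pos _) Finset.univ_nonempty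
  inv := by
    obtain ⟨i⟩ := ‹Nonempty ι›
    refine ExpBdd.of_le fun R => ⟨1, ‖ℓ i‖, fun X _ => ?_⟩
    have h1 : exp (ℓ i X.1) ≤ ∑ i, exp (ℓ i X.1) :=
      Finset.single_le_sum (f := fun i => exp (ℓ i X.1)) (fun i _ => (exp_pos _).le)
        (Finset.mem_univ i)
    have h2 : -ℓ i X.1 ≤ ‖ℓ i‖ * ‖X.1‖ := (neg_le_abs _).trans ((ℓ i).le_opNorm _)
    rw [norm_of_nonneg (inv_nonneg.2 ((exp_pos _).le.trans h1)), one_mul]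
    calc (∑ i, exp (ℓ i X.1))⁻¹ ≤ (exp (ℓ i X.1))⁻¹ := inv_anti₀ (exp_pos _) h1
      _ = exp (-ℓ i X.1) := (exp_neg _).symm
      _ ≤ _ := exp_le_exp.2 h2
  reg := ExpReg.sum _ Finset.univ_nonempty fun i _ => ExpReg.exp_clm (ℓ i)

theorem PosReg.integrable {h : E × ℝ × ℝ → ℝ} (hh : PosReg h) (ℓ : ℝ × ℝ →L[ℝ] ℝ) (w : E)
    (X : E × ℝ × ℝ) :
    Integrable (fun g : ℝ => h (X + g • shiftDir ℓ w X)) (gaussianReal 0 1) := by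
  simpa using integrable_gaussMom hh.reg.continuous hh.reg.expBdd 0 ℓ w X

theorem gaussMom_zero_apply (L : E × ℝ × ℝ →L[ℝ] E × ℝ × ℝ) (h : E × ℝ × ℝ → ℝ)
    (X : E × ℝ × ℝ) : gaussMom 0 L h X = ∫ g, h (X + g • L X) ∂(gaussianReal 0 1) := by
  simp [gaussMom]

theorem PosReg.gaussMom {h : E × ℝ × ℝ → ℝ} (hh : PosReg h) (ℓ : ℝ × ℝ →L[ℝ] ℝ) (w : E) :
    PosReg (gaussMom 0 (shiftDir ℓ w) h) := by
  have key : ∀ R, ∃ C c : ℝ, 0 < c ∧ ∀ X : E × ℝ × ℝ, ‖X.2‖ ≤ R →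
      c * exp (-(C * ‖X.1‖)) ≤ _root_.gaussMom 0 (shiftDir ℓ w) h X := by
    intro R
    obtain ⟨C, hC, hb⟩ := hh.inv.shift ℓ w R
    have i1 := integrable_abs_pow_mul_exp_abs_gaussian 0 (-C)
    simp only [pow_zero, one_mul] at i1
    have hI : 0 < ∫ g, exp (-C * |g|) ∂(gaussianReal 0 1) := integral_exp_pos i1
    refine ⟨C, (C + 1)⁻¹ * ∫ g, exp (-C * |g|) ∂(gaussianReal 0 1), by positivity,
      fun X hX => ?_⟩
    rw [gaussMom_zero_apply]
    have e : (C + 1)⁻¹ * (∫ g, exp (-C * |g|) ∂(gaussianReal 0 1)) * exp (-(C * ‖X.1‖)) =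
        ∫ g, ((C + 1)⁻¹ * exp (-(C * ‖X.1‖))) * exp (-C * |g|) ∂(gaussianReal 0 1) := by
      rw [integral_const_mul]; ring
    rw [e]
    refine integral_mono (i1.const_mul _) (hh.integrable ℓ w X) fun g => ?_
    have h1 := hb X g hX
    have hp := hh.pos (X + g • shiftDir ℓ w X)
    rw [norm_of_nonneg (inv_nonneg.2 hp.le)] at h1
    have h2 : (h (X + g • shiftDir ℓ w X))⁻¹ ≤ (C + 1) * exp (C * ‖X.1‖) * exp (C * |g|) :=
      h1.trans (by gcongr; linarith)
    have h3 := inv_anti₀ (inv_pos.2 hp) h2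
    rw [inv_inv, mul_inv, mul_inv, ← exp_neg, ← exp_neg] at h3
    simpa [neg_mul] using h3
  refine ⟨fun X => ?_, ExpBdd.of_le fun R => ?_, hh.reg.gaussMom ℓ w 0⟩
  · obtain ⟨C, c, hc, h1⟩ := key ‖X.2‖
    exact lt_of_lt_of_le (by positivity) (h1 X le_rfl)
  · obtain ⟨C, c, hc, h1⟩ := key R
    refine ⟨c⁻¹, C, fun X hX => ?_⟩
    have h2 := h1 X hX
    have h3 : 0 < c * exp (-(C * ‖X.1‖)) := by positivity
    rw [norm_of_nonneg (inv_nonneg.2 (h3.le.trans h2))]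
    refine (inv_anti₀ h3 h2).trans_eq ?_
    rw [mul_inv, ← exp_neg, neg_neg]

theorem ExpReg.dir {n : ℕ} {h : E × ℝ × ℝ → ℝ} (hh : ExpReg (n + 1) h) (u : E × ℝ × ℝ) :
    ExpReg n fun X => fderiv ℝ h X u :=
  hh.fderiv_reg.clm (ContinuousLinearMap.apply ℝ ℝ u)

theorem ExpReg.le_one {n : ℕ} {h : E × ℝ × ℝ → ℝ} (hh : ExpReg (n + 1) h) : ExpReg 1 h :=
  ⟨hh.expBdd, _, hh.hasFDerivAt, hh.fderiv_reg.continuous, hh.fderiv_reg.expBdd⟩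

theorem fderiv_gaussMom_apply {n : ℕ} {h : E × ℝ × ℝ → ℝ} (hh : ExpReg (n + 1) h)
    (ℓ : ℝ × ℝ →L[ℝ] ℝ) (w : E) (X u : E × ℝ × ℝ) :
    fderiv ℝ (gaussMom 0 (shiftDir ℓ w) h) X u =
      (∫ g, fderiv ℝ h (X + g • shiftDir ℓ w X) u ∂(gaussianReal 0 1)) +
      ∫ g, g * fderiv ℝ h (X + g • shiftDir ℓ w X) (shiftDir ℓ w u) ∂(gaussianReal 0 1) := by
  have hr := hh.fderiv_reg
  rw [(hasFDerivAt_gaussMom hh.le_one 0 ℓ w X).fderiv]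
  simp only [add_apply, ContinuousLinearMap.comp_apply, gaussMom]
  rw [ContinuousLinearMap.integral_apply (integrable_gaussMom hr.continuous hr.expBdd 0 ℓ w X),
    ContinuousLinearMap.integral_apply (integrable_gaussMom hr.continuous hr.expBdd _ ℓ w X)]
  simp

theorem fderiv_gaussMom_space {n : ℕ} {h : E × ℝ × ℝ → ℝ} (hh : ExpReg (n + 1) h)
    (ℓ : ℝ × ℝ →L[ℝ] ℝ) (w : E) (X : E × ℝ × ℝ) (e : E) :
    fderiv ℝ (gaussMom 0 (shiftDir ℓ w) h) X (e, 0) =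
      gaussMom 0 (shiftDir ℓ w) (fun Y => fderiv ℝ h Y (e, 0)) X := by
  rw [fderiv_gaussMom_apply hh, gaussMom_zero_apply]
  have h0 : shiftDir ℓ w ((e, 0) : E × ℝ × ℝ) = 0 := by
    rw [shiftDir_apply]; simp
  simp only [h0, map_zero, mul_zero, integral_zero, add_zero]

/-- Derivative of the Gaussian smoothing, after integration by parts. -/
theorem fderiv_gaussMom_eq {h : E × ℝ × ℝ → ℝ} (hh : ExpReg 2 h)
    (ℓ : ℝ × ℝ →L[ℝ] ℝ) (w : E) (X u : E × ℝ × ℝ) :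
    fderiv ℝ (gaussMom 0 (shiftDir ℓ w) h) X u =
      (∫ g, fderiv ℝ h (X + g • shiftDir ℓ w X) u ∂(gaussianReal 0 1)) +
      ℓ u.2 * ℓ X.2 * ∫ g, fderiv ℝ (fun Y => fderiv ℝ h Y (w, 0)) (X + g • shiftDir ℓ w X) (w, 0)
        ∂(gaussianReal 0 1) := by
  rw [fderiv_gaussMom_apply hh]
  congr 1
  set L := shiftDir ℓ w
  set k : E × ℝ × ℝ → ℝ := fun Y => fderiv ℝ h Y (w, 0)
  have hk : ExpReg 1 k := hh.dir (w, 0)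
  have hLu : ∀ v : E × ℝ × ℝ, L v = ℓ v.2 • ((w, 0) : E × ℝ × ℝ) := fun v => by simp [L]
  have h1 : ∀ g : ℝ, g * fderiv ℝ h (X + g • L X) (L u) = ℓ u.2 * (g * k (X + g • L X)) := by
    intro g
    rw [hLu u, map_smul, smul_eq_mul]; ring
  simp only [h1]
  rw [integral_const_mul, mul_assoc]
  congr 1
  rw [← integral_const_mul]
  have hd : ∀ g : ℝ, HasDerivAt (fun g : ℝ => k (X + g • L X))
      (ℓ X.2 * fderiv ℝ k (X + g • L X) (w, 0)) g := by
    intro g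
    have h2 : HasDerivAt (fun g : ℝ => X + g • L X) (L X) g := by
      simpa using ((hasDerivAt_id g).smul_const (L X)).const_add X
    refine ((hk.hasFDerivAt _).comp_hasDerivAt g h2).congr_deriv ?_
    rw [hLu X, map_smul, smul_eq_mul]
  have hk' := hk.dir (w, 0)
  obtain ⟨C, hC, hb⟩ := hk.expBdd.shift ℓ w ‖X.2‖
  obtain ⟨C', hC', hb'⟩ := hk'.expBdd.shift ℓ w ‖X.2‖
  have hc := hk'.continuous
  set D := C * exp (C * ‖X.1‖) + |ℓ X.2| * (C' * exp (C' * ‖X.1‖)) + C + C'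
  have hp1 : 0 ≤ C * exp (C * ‖X.1‖) := by positivity
  have hp2 : 0 ≤ |ℓ X.2| * (C' * exp (C' * ‖X.1‖)) := by positivity
  refine integral_mul_gaussian_eq (C := D) hd (by fun_prop) (fun g => ?_) (fun g => ?_)
  · refine (hb X g le_rfl).trans ?_
    have e1 : C * exp (C * ‖X.1‖) ≤ D := by simp only [D]; linarith
    have e2 : C ≤ D := by simp only [D]; linarith
    gcongr
  · rw [abs_mul]
    have e1 : |ℓ X.2| * (C' * exp (C' * ‖X.1‖)) ≤ D := by simp only [D]; linarith
    have e2 : C' ≤ D := by simp only [D]; linarith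
    calc |ℓ X.2| * _ ≤ |ℓ X.2| * (C' * exp (C' * ‖X.1‖) * exp (C' * |g|)) := by
          gcongr; exact hb' X g le_rfl
      _ = |ℓ X.2| * (C' * exp (C' * ‖X.1‖)) * exp (C' * |g|) := by ring
      _ ≤ _ := by gcongr

end Flow

section GuerraFlow

variable {V : Type} [Fintype V] [DecidableEq V]

/-- Second derivative of `h` in the coordinate directions `s`, `t`. -/
noncomputable def hess (h : (V → ℝ) × ℝ × ℝ → ℝ) (s t : V) (X : (V → ℝ) × ℝ × ℝ) : ℝ :=
  fderiv ℝ (fun Y => fderiv ℝ h Y (Pi.single s 1, 0)) X (Pi.single t 1, 0)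

/-- The differential inequality propagated through the levels of Guerra's scheme: along
the rotation of the two amplitudes, `h` decreases at least as fast as its Hessian contracted with
the covariance deficit `K`. -/
structure GuerraFlow (K : V → V → ℝ) (h : (V → ℝ) × ℝ × ℝ → ℝ) : Prop extends PosReg h where
  mono : ∀ s X, 0 ≤ fderiv ℝ h X (Pi.single s 1, 0)
  flow : ∀ z c d, 0 ≤ c → 0 ≤ d → fderiv ℝ h (z, c, d) (0, -d, c) +
    c * d * ∑ s, ∑ t, K s t * hess h s t (z, c, d) ≤ 0

theorem continuous_hess {h : (V → ℝ) × ℝ × ℝ → ℝ} (hh : ExpReg 2 h) (s t : V) :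
    Continuous (hess h s t) := ((hh.dir _).dir _).continuous

theorem hess_gaussMom {h : (V → ℝ) × ℝ × ℝ → ℝ} (hh : ExpReg 2 h) (ℓ : ℝ × ℝ →L[ℝ] ℝ)
    (w : V → ℝ) (s t : V) (X : (V → ℝ) × ℝ × ℝ) :
    hess (gaussMom 0 (shiftDir ℓ w) h) s t X = gaussMom 0 (shiftDir ℓ w) (hess h s t) X := by
  unfold hess
  simp only [fderiv_gaussMom_space hh]
  rw [fderiv_gaussMom_space (hh.dir _)]

theorem fderiv_fderiv_eq_sum_hess {h : (V → ℝ) × ℝ × ℝ → ℝ} (hh : ExpReg 2 h) (w : V → ℝ)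
    (X : (V → ℝ) × ℝ × ℝ) :
    fderiv ℝ (fun Y => fderiv ℝ h Y (w, 0)) X (w, 0) = ∑ s, ∑ t, w s * w t * hess h s t X := by
  have hw : ((w, 0) : (V → ℝ) × ℝ × ℝ) =
      ∑ s, w s • ((Pi.single s 1, 0) : (V → ℝ) × ℝ × ℝ) := by
    ext s <;> simp [Prod.fst_sum, Prod.snd_sum, Finset.sum_apply, Pi.single_apply]
  have h1 : (fun Y => fderiv ℝ h Y (w, 0)) =
      fun Y => ∑ s, w s * fderiv ℝ h Y ((Pi.single s 1, 0) : (V → ℝ) × ℝ × ℝ) := by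
    ext Y
    conv_lhs => rw [hw]
    simp only [map_sum, map_smul, smul_eq_mul]
  rw [h1, fderiv_fun_sum fun s _ => ((hh.dir _).hasFDerivAt X).differentiableAt.const_mul (w s)]
  rw [sum_apply]
  refine Finset.sum_congr rfl fun s _ => ?_
  rw [fderiv_const_mul ((hh.dir _).hasFDerivAt X).differentiableAt]
  rw [hw, map_sum]
  refine Finset.sum_congr rfl fun t _ => ?_
  simp only [map_smul, smul_apply, smul_eq_mul, hess]
  ring

theorem GuerraFlow.gaussMom {K : V → V → ℝ} {h : (V → ℝ) × ℝ × ℝ → ℝ} (hh : GuerraFlow K h)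
    (ℓ : ℝ × ℝ →L[ℝ] ℝ) (ε : ℝ) (hℓ : ∀ c d, ℓ (-d, c) * ℓ (c, d) = ε * (c * d)) (w : V → ℝ) :
    GuerraFlow (fun s t => K s t - ε * (w s * w t)) (gaussMom 0 (shiftDir ℓ w) h) where
  toPosReg := hh.toPosReg.gaussMom ℓ w
  mono s X := by
    rw [fderiv_gaussMom_space hh.reg, gaussMom_zero_apply]
    exact integral_nonneg fun g => hh.mono s _
  flow z c d hc hd := by
    set X : (V → ℝ) × ℝ × ℝ := (z, c, d)
    have iH : ∀ s t, Integrable (fun g : ℝ => hess h s t (X + g • shiftDir ℓ w X))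
        (gaussianReal 0 1) := fun s t => by
      simpa using integrable_gaussMom (continuous_hess hh.reg s t)
        ((hh.reg.dir _).dir _).expBdd 0 ℓ w X
    have iD : Integrable (fun g : ℝ => fderiv ℝ h (X + g • shiftDir ℓ w X) (0, -d, c))
        (gaussianReal 0 1) := by
      simpa using integrable_gaussMom (hh.reg.dir (0, -d, c)).continuous
        (hh.reg.dir (0, -d, c)).expBdd 0 ℓ w X
    rw [fderiv_gaussMom_eq hh.reg]
    simp only [fderiv_fderiv_eq_sum_hess hh.reg, hess_gaussMom hh.reg, gaussMom_zero_apply]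
    have e1 : ∀ a : V → V → ℝ,
        ∫ g, ∑ s, ∑ t, a s t * hess h s t (X + g • shiftDir ℓ w X) ∂(gaussianReal 0 1) =
        ∑ s, ∑ t, a s t * ∫ g, hess h s t (X + g • shiftDir ℓ w X) ∂(gaussianReal 0 1) := by
      intro a
      rw [integral_finsetSum _ fun s _ => integrable_finsetSum _ fun t _ => (iH s t).const_mul _]
      refine Finset.sum_congr rfl fun s _ => ?_
      rw [integral_finsetSum _ fun t _ => (iH s t).const_mul _]
      exact Finset.sum_congr rfl fun t _ => integral_const_mul _ _
    have e2 : ∫ g, (fderiv ℝ h (X + g • shiftDir ℓ w X) (0, -d, c) +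
        c * d * ∑ s, ∑ t, K s t * hess h s t (X + g • shiftDir ℓ w X)) ∂(gaussianReal 0 1) ≤ 0 := by
      refine integral_nonpos fun g => ?_
      have := hh.flow (z + g • (ℓ (c, d) • w)) c d hc hd
      have hX : X + g • shiftDir ℓ w X = (z + g • (ℓ (c, d) • w), c, d) := by
        simp [X]
      rw [hX]; exact this
    rw [integral_add iD ((integrable_finsetSum _ fun s _ => integrable_finsetSum _ fun t _ =>
      (iH s t).const_mul _).const_mul _), integral_const_mul, e1] at e2
    rw [e1]
    have e3 : ℓ ((0, -d, c) : (V → ℝ) × ℝ × ℝ).2 * ℓ X.2 = ε * (c * d) := hℓ c d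
    rw [e3]
    simp only [sub_mul, Finset.sum_sub_distrib, mul_assoc ε]
    simp only [← Finset.mul_sum] at e2 ⊢
    linarith

theorem GuerraFlow.rpow {K : V → V → ℝ} {h : (V → ℝ) × ℝ × ℝ → ℝ} (hh : GuerraFlow K h)
    (hK : ∀ s t, 0 ≤ K s t) {θ : ℝ} (h0 : 0 ≤ θ) (h1 : θ ≤ 1) :
    GuerraFlow K (fun X => h X ^ θ) := by
  have hd : ∀ X u, fderiv ℝ (fun X => h X ^ θ) X u = θ * h X ^ (θ - 1) * fderiv ℝ h X u := by
    intro X u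
    rw [((hh.reg.hasFDerivAt X).rpow_const (Or.inl (hh.pos X).ne')).fderiv]
    simp
  have hd2 : ∀ s t X, hess (fun X => h X ^ θ) s t X = θ * h X ^ (θ - 1) * hess h s t X +
      θ * (θ - 1) * h X ^ (θ - 2) * (fderiv ℝ h X (Pi.single s 1, 0) *
        fderiv ℝ h X (Pi.single t 1, 0)) := by
    intro s t X
    unfold hess
    simp only [hd]
    have a1 := ((hh.reg.hasFDerivAt X).rpow_const (p := θ - 1) (Or.inl (hh.pos X).ne')).const_mul θ
    have a2 := (hh.reg.dir (Pi.single s 1, 0)).hasFDerivAt X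
    rw [(a1.fun_mul a2).fderiv]
    simp only [add_apply, smul_apply, smul_eq_mul]
    rw [show θ - 1 - 1 = θ - 2 by ring]
    ring
  refine ⟨hh.toPosReg.rpow θ, fun s X => ?_, fun z c d hc hdd => ?_⟩
  · rw [hd]
    exact mul_nonneg (mul_nonneg h0 (rpow_pos_of_pos (hh.pos X) _).le) (hh.mono s X)
  · rw [hd]
    simp only [hd2]
    set X : (V → ℝ) × ℝ × ℝ := (z, c, d)
    have e1 : ∑ s, ∑ t, K s t * (θ * h X ^ (θ - 1) * hess h s t X +
        θ * (θ - 1) * h X ^ (θ - 2) * (fderiv ℝ h X (Pi.single s 1, 0) *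
        fderiv ℝ h X (Pi.single t 1, 0))) =
        θ * h X ^ (θ - 1) * ∑ s, ∑ t, K s t * hess h s t X +
        θ * (θ - 1) * h X ^ (θ - 2) * ∑ s, ∑ t, K s t * (fderiv ℝ h X (Pi.single s 1, 0) *
        fderiv ℝ h X (Pi.single t 1, 0)) := by
      simp only [Finset.mul_sum, ← Finset.sum_add_distrib]
      refine Finset.sum_congr rfl fun s _ => Finset.sum_congr rfl fun t _ => by ring
    rw [e1]
    have p1 : 0 ≤ θ * h X ^ (θ - 1) := mul_nonneg h0 (rpow_pos_of_pos (hh.pos X) _).le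
    have p2 : 0 ≤ θ * (1 - θ) * h X ^ (θ - 2) :=
      mul_nonneg (mul_nonneg h0 (by linarith)) (rpow_pos_of_pos (hh.pos X) _).le
    have p3 : 0 ≤ ∑ s, ∑ t, K s t * (fderiv ℝ h X (Pi.single s 1, 0) *
        fderiv ℝ h X (Pi.single t 1, 0)) :=
      Finset.sum_nonneg fun s _ => Finset.sum_nonneg fun t _ =>
        mul_nonneg (hK s t) (mul_nonneg (hh.mono s X) (hh.mono t X))
    have q1 := mul_nonpos_of_nonneg_of_nonpos p1 (hh.flow z c d hc hdd)
    have q2 := mul_nonneg (mul_nonneg hc hdd) (mul_nonneg p2 p3)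
    nlinarith [q1, q2]

/-- The partition function as a function of the field. -/
noncomputable def partFn (X : (V → ℝ) × ℝ × ℝ) : ℝ := ∑ s, exp (X.1 s)

theorem guerraFlow_partFn [Nonempty V] {K : V → V → ℝ} (hK : ∀ s, K s s = 0) :
    GuerraFlow K (partFn (V := V)) := by
  have hP : PosReg (partFn (V := V)) :=
    PosReg.sum_exp fun s => (ContinuousLinearMap.proj s : (V → ℝ) →L[ℝ] ℝ)
  have hd : ∀ X u : (V → ℝ) × ℝ × ℝ, fderiv ℝ partFn X u = ∑ s, exp (X.1 s) * u.1 s := by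
    intro X u
    have h1 : ∀ s : V, HasFDerivAt (fun X : (V → ℝ) × ℝ × ℝ => exp (X.1 s)) _ X := fun s =>
      (((ContinuousLinearMap.proj s : (V → ℝ) →L[ℝ] ℝ).comp
        (ContinuousLinearMap.fst ℝ (V → ℝ) (ℝ × ℝ))).hasFDerivAt (x := X)).exp
    have h2 := HasFDerivAt.fun_sum (u := Finset.univ) fun s _ => h1 s
    unfold partFn
    rw [h2.fderiv, sum_apply]
    simp
  have hd1 : ∀ s (X : (V → ℝ) × ℝ × ℝ), fderiv ℝ partFn X (Pi.single s 1, 0) = exp (X.1 s) := by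
    intro s X
    rw [hd, Finset.sum_eq_single s] <;> simp +contextual
  have hd2 : ∀ s t (X : (V → ℝ) × ℝ × ℝ), s ≠ t → hess partFn s t X = 0 := by
    intro s t X hst
    unfold hess
    simp only [hd1]
    have h1 := (((ContinuousLinearMap.proj s : (V → ℝ) →L[ℝ] ℝ).comp
        (ContinuousLinearMap.fst ℝ (V → ℝ) (ℝ × ℝ))).hasFDerivAt (x := X)).exp
    have h2 : HasFDerivAt (fun X : (V → ℝ) × ℝ × ℝ => exp (X.1 s)) _ X := h1
    rw [h2.fderiv]
    simp [hst]
  refine ⟨hP, fun s X => ?_, fun z c d hc hdd => ?_⟩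
  · rw [hd1]; exact (exp_pos _).le
  · rw [hd]
    have : ∑ s, ∑ t, K s t * hess partFn s t (z, c, d) = 0 := by
      refine Finset.sum_eq_zero fun s _ => Finset.sum_eq_zero fun t _ => ?_
      rcases eq_or_ne s t with rfl | hst
      · rw [hK, zero_mul]
      · rw [hd2 s t _ hst, mul_zero]
    rw [this]
    simp

/-- Without covariance deficit, the value decreases along the rotation of the amplitudes. -/
theorem GuerraFlow.le {K : V → V → ℝ} {h : (V → ℝ) × ℝ × ℝ → ℝ} (hh : GuerraFlow K h)
    (hK : ∀ s t, K s t = 0) (z : V → ℝ) : h (z, 0, 1) ≤ h (z, 1, 0) := by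
  have hd : ∀ φ : ℝ, HasDerivAt (fun φ : ℝ => h (z, cos φ, sin φ))
      (fderiv ℝ h (z, cos φ, sin φ) (0, -sin φ, cos φ)) φ := by
    intro φ
    have h1 : HasDerivAt (fun φ : ℝ => (z, cos φ, sin φ)) ((0 : V → ℝ), -sin φ, cos φ) φ :=
      (hasDerivAt_const φ z).prodMk ((hasDerivAt_cos φ).prodMk (hasDerivAt_sin φ))
    exact (hh.reg.hasFDerivAt _).comp_hasDerivAt φ h1
  have hanti : AntitoneOn (fun φ : ℝ => h (z, cos φ, sin φ)) (Set.Icc 0 (π / 2)) := by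
    refine antitoneOn_of_deriv_nonpos (convex_Icc _ _)
      (fun φ _ => (hd φ).continuousAt.continuousWithinAt)
      (fun φ _ => (hd φ).differentiableAt.differentiableWithinAt) fun φ hφ => ?_
    rw [interior_Icc] at hφ
    rw [(hd φ).deriv]
    have := hh.flow z (cos φ) (sin φ)
      (cos_nonneg_of_mem_Icc ⟨by linarith [hφ.1, pi_pos], hφ.2.le⟩)
      (sin_nonneg_of_mem_Icc ⟨hφ.1.le, by linarith [hφ.2, pi_pos]⟩)
    simpa [hK] using this
  have := hanti (Set.left_mem_Icc.2 (by positivity)) (Set.right_mem_Icc.2 (by positivity))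
    (by positivity : (0 : ℝ) ≤ π / 2)
  simpa using this

end GuerraFlow

section Smooth

variable {V : Type} [Fintype V]

/-- Successive Gaussian smoothings in the directions of the list `L`. -/
noncomputable def smooth (ℓ : ℝ × ℝ →L[ℝ] ℝ) (L : List (V → ℝ)) (h : (V → ℝ) × ℝ × ℝ → ℝ) :
    (V → ℝ) × ℝ × ℝ → ℝ :=
  L.foldr (fun w k => gaussMom 0 (shiftDir ℓ w) k) h

theorem smooth_cons_apply (ℓ : ℝ × ℝ →L[ℝ] ℝ) (w : V → ℝ) (L : List (V → ℝ))
    (h : (V → ℝ) × ℝ × ℝ → ℝ) (z : V → ℝ) (a : ℝ × ℝ) :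
    smooth ℓ (w :: L) h (z, a) = ∫ g, smooth ℓ L h (z + (g * ℓ a) • w, a) ∂(gaussianReal 0 1) := by
  simp only [smooth, List.foldr_cons]
  rw [gaussMom_zero_apply]
  simp [smul_smul]

theorem smooth_of_eq_zero {ℓ : ℝ × ℝ →L[ℝ] ℝ} {a : ℝ × ℝ} (ha : ℓ a = 0) (L : List (V → ℝ))
    (h : (V → ℝ) × ℝ × ℝ → ℝ) (z : V → ℝ) : smooth ℓ L h (z, a) = h (z, a) := by
  induction L with
  | nil => rfl
  | cons w L ih => rw [smooth_cons_apply]; simp [ha, ih]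

theorem PosReg.smooth {h : (V → ℝ) × ℝ × ℝ → ℝ} (hh : PosReg h) (ℓ : ℝ × ℝ →L[ℝ] ℝ)
    (L : List (V → ℝ)) : PosReg (smooth ℓ L h) := by
  induction L with
  | nil => exact hh
  | cons w L ih => exact ih.gaussMom ℓ w

theorem GuerraFlow.smooth [DecidableEq V] {K : V → V → ℝ} {h : (V → ℝ) × ℝ × ℝ → ℝ}
    (hh : GuerraFlow K h) (ℓ : ℝ × ℝ →L[ℝ] ℝ) (ε : ℝ)
    (hℓ : ∀ c d, ℓ (-d, c) * ℓ (c, d) = ε * (c * d)) (L : List (V → ℝ)) :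
    GuerraFlow (fun s t => K s t - ε * (L.map fun w => w s * w t).sum) (smooth ℓ L h) := by
  induction L with
  | nil => simpa [_root_.smooth] using hh
  | cons w L ih =>
    convert ih.gaussMom ℓ ε hℓ w using 3
    · simp only [List.map_cons, List.sum_cons]
      ring
    · rfl

/-- The iterated smoothing is a Gaussian expectation. -/
theorem lintegral_pi_eq_smooth {ι : Type} [Fintype ι] [DecidableEq ι]
    {h : (V → ℝ) × ℝ × ℝ → ℝ} (hh : PosReg h)
    {ℓ : ℝ × ℝ →L[ℝ] ℝ} {a : ℝ × ℝ} (ha : ℓ a = 1) (w : ι → V → ℝ) (z : V → ℝ) :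
    ∫⁻ W, ENNReal.ofReal (h (z + ∑ i, W i • w i, a)) ∂(Measure.pi fun _ : ι => gaussianReal 0 1) =
      ENNReal.ofReal (smooth ℓ (Finset.univ.toList.map w) h (z, a)) := by
  have hcont := hh.reg.continuous
  have hF : Measurable fun W : ι → ℝ => ENNReal.ofReal (h (z + ∑ i, W i • w i, a)) := by
    refine ENNReal.measurable_ofReal.comp (Continuous.measurable ?_)
    fun_prop
  have key : ∀ L : List ι, L.Nodup → ∀ W : ι → ℝ,
      (∫⋯∫⁻_L.toFinset, (fun W : ι → ℝ => ENNReal.ofReal (h (z + ∑ i, W i • w i, a)))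
        ∂(fun _ : ι => gaussianReal 0 1)) W =
      ENNReal.ofReal (smooth ℓ (L.map w) h (z + ∑ i ∈ L.toFinsetᶜ, W i • w i, a)) := by
    intro L
    induction L with
    | nil => intro _ W; simp [smooth]
    | cons j L ih =>
      intro hL W
      rw [List.nodup_cons] at hL
      have hj : j ∉ L.toFinset := by simpa using hL.1
      rw [List.toFinset_cons, lmarginal_insert _ hF hj]
      have e : ∀ g : ℝ, z + ∑ i ∈ L.toFinsetᶜ, Function.update W j g i • w i =
          (z + ∑ i ∈ (insert j L.toFinset)ᶜ, W i • w i) + (g * ℓ a) • w j := by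
        intro g
        rw [ha, mul_one, add_assoc]
        congr 1
        rw [Finset.compl_insert, ← Finset.sum_erase_add _ _ (Finset.mem_compl.2 hj)]
        congr 1
        · refine Finset.sum_congr rfl fun i hi => ?_
          rw [Function.update_of_ne (Finset.ne_of_mem_erase hi)]
        · simp
      simp only [ih hL.2, e]
      rw [List.map_cons, smooth_cons_apply]
      have hs := hh.smooth ℓ (L.map w)
      rw [ofReal_integral_eq_lintegral_ofReal]
      · have := hs.integrable ℓ (w j) (z + ∑ i ∈ (insert j L.toFinset)ᶜ, W i • w i, a)
        simpa [smul_smul] using this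
      · exact ae_of_all _ fun g => (hs.pos _).le
  have := key Finset.univ.toList (Finset.nodup_toList _) 0
  rw [Finset.toList_toFinset, lmarginal_univ] at this
  simpa using this

end Smooth

section Scheme

/-- Ising configurations. -/
abbrev Spins (N : ℕ) : Type := Fin N → ({-1, 1} : Finset ℝ)

instance : Nonempty ({-1, 1} : Finset ℝ) := ⟨⟨1, by simp⟩⟩

theorem sq_spin (s : ({-1, 1} : Finset ℝ)) : (s : ℝ) * s = 1 := by
  obtain ⟨s, hs⟩ := s
  simp only [Finset.mem_insert, Finset.mem_singleton] at hs
  rcases hs with rfl | rfl <;> norm_num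

/-- Gaussian convolution with standard deviation `τ`. -/
noncomputable def heat (τ : ℝ) (f : ℝ → ℝ) (x : ℝ) : ℝ := ∫ g, f (x + g * τ) ∂(gaussianReal 0 1)

/-- The one-site recursion with levels `q` and parameters `m`. -/
noncomputable def cavity (β : ℝ) (q m : ℕ → ℝ) : ℕ → ℝ → ℝ
  | 0 => fun x => exp x + exp (-x)
  | j + 1 => heat (√(2 * β ^ 2 * (q j - q (j + 1))))
      fun x => cavity β q m j x ^ (m (j + 1) / m j)

/-- The interpolating functional of Guerra's scheme with levels `q` and parameters `m`. -/
noncomputable def guerraLevel (N : ℕ) (β : ℝ) (q m : ℕ → ℝ) :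
    ℕ → (Spins N → ℝ) × ℝ × ℝ → ℝ
  | 0 => partFn
  | j + 1 => smooth (ContinuousLinearMap.snd ℝ ℝ ℝ)
      [fun _ => √(N * β ^ 2 * (q j ^ 2 - q (j + 1) ^ 2))]
      (smooth (ContinuousLinearMap.fst ℝ ℝ ℝ)
        (Finset.univ.toList.map fun (l : Fin N) (σ : Spins N) =>
          √(2 * β ^ 2 * (q j - q (j + 1))) * (σ l : ℝ))
        fun X => guerraLevel N β q m j X ^ (m (j + 1) / m j))

/-- The overlap of two configurations. -/
noncomputable def overlap {N : ℕ} (σ ρ : Spins N) : ℝ := (∑ l, (σ l : ℝ) * ρ l) / N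

theorem guerraFlow_guerraLevel {N : ℕ} (hN : 1 ≤ N) (β : ℝ) {q m : ℕ → ℝ} (hq0 : q 0 = 1)
    {k : ℕ} (hq : ∀ j < k, q (j + 1) ≤ q j) (hqk : ∀ j ≤ k, 0 ≤ q j)
    (hm : ∀ j ≤ k, 0 < m j) (hm' : ∀ j < k, m (j + 1) ≤ m j) : ∀ j ≤ k,
    GuerraFlow (fun σ ρ => N * β ^ 2 * (overlap σ ρ - q j) ^ 2) (guerraLevel N β q m j) := by
  have hN' : (N : ℝ) ≠ 0 := by positivity
  intro j
  induction j with
  | zero =>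
    intro _
    refine guerraFlow_partFn fun σ => ?_
    have : overlap σ σ = 1 := by simp [overlap, sq_spin, hN']
    rw [this, hq0]; ring
  | succ j ih =>
    intro hj
    have h1 := (ih (by omega)).rpow (fun s t => by positivity)
      (div_nonneg (hm (j + 1) hj).le (hm j (by omega)).le)
      (div_le_one_of_le₀ (hm' j hj) (hm j (by omega)).le)
    have h2 := h1.smooth (ContinuousLinearMap.fst ℝ ℝ ℝ) (-1) (fun c d => by simp; ring)
      (Finset.univ.toList.map fun (l : Fin N) (σ : Spins N) =>
          √(2 * β ^ 2 * (q j - q (j + 1))) * (σ l : ℝ))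
    have h3 := h2.smooth (ContinuousLinearMap.snd ℝ ℝ ℝ) 1 (fun c d => by simp)
      [fun _ => √(N * β ^ 2 * (q j ^ 2 - q (j + 1) ^ 2))]
    convert h3 using 3 with σ ρ
    swap
    · rfl
    have e1 : 0 ≤ 2 * β ^ 2 * (q j - q (j + 1)) :=
      mul_nonneg (by positivity) (sub_nonneg.2 (hq j hj))
    have e2 : 0 ≤ N * β ^ 2 * (q j ^ 2 - q (j + 1) ^ 2) :=
      mul_nonneg (by positivity) (sub_nonneg.2 (pow_le_pow_left₀ (hqk _ hj) (hq j hj) 2))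
    have e3 : ∑ l, (σ l : ℝ) * ρ l = N * overlap σ ρ := by unfold overlap; field_simp
    simp only [List.map_map, List.map_cons, List.map_nil, List.sum_cons, List.sum_nil, add_zero,
      mul_self_sqrt e2, Finset.sum_map_toList, Function.comp_apply]
    simp only [mul_mul_mul_comm _ _ (√(2 * β ^ 2 * (q j - q (j + 1)))), mul_self_sqrt e1,
      ← Finset.mul_sum, e3]
    ring

theorem posReg_guerraLevel (N : ℕ) (β : ℝ) (q m : ℕ → ℝ) (j : ℕ) :
    PosReg (guerraLevel N β q m j) := by
  induction j with
  | zero => exact PosReg.sum_exp fun s => (ContinuousLinearMap.proj s : (Spins N → ℝ) →L[ℝ] ℝ)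
  | succ j ih => exact ((ih.rpow _).smooth _ _).smooth _ _

/-- The linear field `σ ↦ ∑ x_l σ_l`. -/
noncomputable def linField {N : ℕ} (x : Fin N → ℝ) (σ : Spins N) : ℝ := ∑ l, x l * (σ l : ℝ)

theorem partFn_linField {N : ℕ} (x : Fin N → ℝ) (a : ℝ × ℝ) :
    partFn (linField x, a) = ∏ l, (exp (x l) + exp (-x l)) := by
  have h1 : ∀ y : ℝ, exp y + exp (-y) = ∑ s : ({-1, 1} : Finset ℝ), exp (y * (s : ℝ)) := by
    intro y
    rw [Finset.sum_coe_sort ({-1, 1} : Finset ℝ) fun s => exp (y * s),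
      Finset.sum_pair (by norm_num)]
    simp [add_comm]
  simp only [h1, partFn, linField, exp_sum]
  rw [Finset.prod_univ_sum, Fintype.piFinset_univ]

theorem smooth_linField {N : ℕ} {h : (Spins N → ℝ) × ℝ × ℝ → ℝ} {ℓ : ℝ × ℝ →L[ℝ] ℝ} {a : ℝ × ℝ}
    (ha : ℓ a = 1) {ψ : ℝ → ℝ} (hψ : ∀ x, h (linField x, a) = ∏ l, ψ (x l)) (τ : ℝ)
    (L : List (Fin N)) (x : Fin N → ℝ) :
    smooth ℓ (L.map fun (l : Fin N) (σ : Spins N) => τ * (σ l : ℝ)) h (linField x, a) =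
      ∏ l, (heat τ)^[L.count l] ψ (x l) := by
  induction L generalizing x with
  | nil => simp [smooth, hψ]
  | cons i L ih =>
    rw [List.map_cons, smooth_cons_apply]
    have e : ∀ g : ℝ, (linField x + (g * ℓ a) • fun σ : Spins N => τ * (σ i : ℝ)) =
        linField (Function.update x i (x i + g * τ)) := by
      intro g
      ext σ
      simp only [linField, ha, Pi.add_apply, Pi.smul_apply, smul_eq_mul, mul_one]
      rw [← Finset.add_sum_erase _ _ (Finset.mem_univ i),
        ← Finset.add_sum_erase _ (fun l => Function.update x i (x i + g * τ) l * (σ l : ℝ))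
          (Finset.mem_univ i)]
      have : ∑ l ∈ Finset.univ.erase i, Function.update x i (x i + g * τ) l * (σ l : ℝ) =
          ∑ l ∈ Finset.univ.erase i, x l * (σ l : ℝ) :=
        Finset.sum_congr rfl fun l hl => by
          rw [Function.update_of_ne (Finset.ne_of_mem_erase hl)]
      rw [this, Function.update_self]
      ring
    simp only [e, ih]
    rw [← Finset.mul_prod_erase _ _ (Finset.mem_univ i)]
    have e2 : ∀ g : ℝ, ∏ l, (heat τ)^[L.count l] ψ (Function.update x i (x i + g * τ) l) =
        (heat τ)^[L.count i] ψ (x i + g * τ) *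
          ∏ l ∈ Finset.univ.erase i, (heat τ)^[(i :: L).count l] ψ (x l) := by
      intro g
      rw [← Finset.mul_prod_erase _ _ (Finset.mem_univ i), Function.update_self]
      congr 1
      refine Finset.prod_congr rfl fun l hl => ?_
      have hl := Finset.ne_of_mem_erase hl
      rw [Function.update_of_ne hl, List.count_cons_of_ne hl.symm]
    simp only [e2]
    rw [integral_mul_const, List.count_cons_self, Function.iterate_succ_apply']
    rfl

theorem guerraLevel_linField (N : ℕ) (β : ℝ) (q m : ℕ → ℝ) (hc : ∀ j x, 0 ≤ cavity β q m j x)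
    (j : ℕ) (x : Fin N → ℝ) :
    guerraLevel N β q m j (linField x, 1, 0) = ∏ l, cavity β q m j (x l) := by
  induction j generalizing x with
  | zero => exact partFn_linField x _
  | succ j ih =>
    rw [guerraLevel, smooth_of_eq_zero (by simp),
      smooth_linField (ψ := fun x => cavity β q m j x ^ (m (j + 1) / m j)) (by simp)
        (fun x => by rw [ih, finsetProd_rpow _ _ fun l _ => hc j _])]
    refine Finset.prod_congr rfl fun l _ => ?_
    rw [List.count_eq_one_of_mem (Finset.nodup_toList _) (by simp)]
    rfl

/-- The accumulated correction of the scheme. -/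
noncomputable def correction (β : ℝ) (q m : ℕ → ℝ) (j : ℕ) : ℝ :=
  ∑ i ∈ Finset.range j, m (i + 1) * β ^ 2 * (q i ^ 2 - q (i + 1) ^ 2) / 2

theorem guerraLevel_zero_one {N : ℕ} (β : ℝ) {q m : ℕ → ℝ} {k : ℕ} (hm0 : m 0 = 1)
    (hq : ∀ j < k, q (j + 1) ≤ q j) (hqk : ∀ j ≤ k, 0 ≤ q j) (hm : ∀ j ≤ k, 0 < m j)
    (j : ℕ) (hj : j ≤ k) (z : Spins N → ℝ) :
    guerraLevel N β q m j (z, 0, 1) =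
      (∑ σ, exp (z σ)) ^ m j * exp (m j * (N * correction β q m j)) := by
  induction j generalizing z with
  | zero => simp [guerraLevel, partFn, correction, hm0]
  | succ j ih =>
    set a := √(N * β ^ 2 * (q j ^ 2 - q (j + 1) ^ 2)) with ha
    have e2 : 0 ≤ N * β ^ 2 * (q j ^ 2 - q (j + 1) ^ 2) :=
      mul_nonneg (by positivity) (sub_nonneg.2 (pow_le_pow_left₀ (hqk _ hj) (hq j hj) 2))
    have ha2 : a ^ 2 = N * β ^ 2 * (q j ^ 2 - q (j + 1) ^ 2) := sq_sqrt e2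
    rw [guerraLevel, smooth_cons_apply, ← ha]
    have hmj := hm j (by omega)
    have e : ∀ g : ℝ, smooth (ContinuousLinearMap.snd ℝ ℝ ℝ) []
        (smooth (ContinuousLinearMap.fst ℝ ℝ ℝ)
        (Finset.univ.toList.map fun (l : Fin N) (σ : Spins N) =>
          √(2 * β ^ 2 * (q j - q (j + 1))) * (σ l : ℝ))
        fun X => guerraLevel N β q m j X ^ (m (j + 1) / m j))
        (z + (g * ContinuousLinearMap.snd ℝ ℝ ℝ (0, 1)) • fun _ => a, 0, 1) =
        (∑ σ, exp (z σ)) ^ m (j + 1) * exp (m (j + 1) * (N * correction β q m j)) *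
          exp ((m (j + 1) * a) * g) := by
      intro g
      have hS : 0 < ∑ σ, exp (z σ) := Finset.sum_pos (fun _ _ => exp_pos _) Finset.univ_nonempty
      have hS' : ∑ σ, exp ((z + (g * (1 : ℝ)) • fun _ : Spins N => a) σ) =
          (∑ σ, exp (z σ)) * exp (a * g) := by
        rw [Finset.sum_mul]
        refine Finset.sum_congr rfl fun σ _ => ?_
        simp only [Pi.add_apply, Pi.smul_apply, smul_eq_mul]
        rw [← exp_add]; ring_nf
      simp only [smooth, List.foldr_nil]
      rw [← smooth, smooth_of_eq_zero (by simp), ih (by omega)]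
      simp only [ContinuousLinearMap.coe_snd', hS']
      rw [mul_rpow (by positivity) (exp_pos _).le, ← rpow_mul (by positivity),
        mul_rpow hS.le (exp_pos _).le, ← exp_mul, ← exp_mul, mul_div_cancel₀ _ hmj.ne']
      rw [mul_assoc, ← exp_add, mul_assoc (_ ^ _) (exp _), ← exp_add]
      congr 2
      field_simp
      ring
    simp only [e]
    rw [integral_const_mul]
    have hmgf : ∫ g, exp ((m (j + 1) * a) * g) ∂(gaussianReal 0 1) =
        exp ((m (j + 1) * a) ^ 2 / 2) := by
      have := congrFun (mgf_id_gaussianReal (μ := 0) (v := 1)) (m (j + 1) * a)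
      simpa [mgf] using this
    rw [hmgf, mul_assoc, ← exp_add]
    congr 2
    rw [mul_pow, ha2, correction, correction, Finset.sum_range_succ]
    ring

end Scheme

section Bound

theorem integrable_pi_shift {V : Type} [Fintype V] {ι : Type} [Fintype ι] [DecidableEq ι]
    {h : (V → ℝ) × ℝ × ℝ → ℝ} (hh : PosReg h)
    {ℓ : ℝ × ℝ →L[ℝ] ℝ} {a : ℝ × ℝ} (ha : ℓ a = 1) (w : ι → V → ℝ) (z : V → ℝ) :
    Integrable (fun W : ι → ℝ => h (z + ∑ i, W i • w i, a))
      (Measure.pi fun _ : ι => gaussianReal 0 1) := by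
  have hcont := hh.reg.continuous
  refine (lintegral_ofReal_ne_top_iff_integrable
    (Continuous.aestronglyMeasurable (by fun_prop)) (ae_of_all _ fun W => (hh.pos _).le)).1 ?_
  rw [lintegral_pi_eq_smooth hh ha]
  exact ENNReal.ofReal_ne_top

theorem integral_pi_eq_smooth {V : Type} [Fintype V] {ι : Type} [Fintype ι] [DecidableEq ι]
    {h : (V → ℝ) × ℝ × ℝ → ℝ} (hh : PosReg h)
    {ℓ : ℝ × ℝ →L[ℝ] ℝ} {a : ℝ × ℝ} (ha : ℓ a = 1) (w : ι → V → ℝ) (z : V → ℝ) :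
    ∫ W, h (z + ∑ i, W i • w i, a) ∂(Measure.pi fun _ : ι => gaussianReal 0 1) =
      smooth ℓ (Finset.univ.toList.map w) h (z, a) := by
  have h1 := lintegral_pi_eq_smooth hh ha w z
  rw [← ofReal_integral_eq_lintegral_ofReal (integrable_pi_shift hh ha w z)
    (ae_of_all _ fun W => (hh.pos _).le)] at h1
  exact (ENNReal.ofReal_eq_ofReal_iff (integral_nonneg fun W => (hh.pos _).le)
    ((hh.smooth _ _).pos _).le).1 h1

/-- The covariance directions of the Hamiltonian. -/
noncomputable def couplingDir (N : ℕ) (β : ℝ) (p : Fin N × Fin N) (σ : Spins N) : ℝ :=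
  β / √N * ((σ p.1 : ℝ) * σ p.2)

theorem sum_couplingDir (N : ℕ) (β : ℝ) (W : Fin N × Fin N → ℝ) (σ : Spins N) :
    (∑ p, W p • couplingDir N β p) σ = β * HSK N W fun i => (σ i : ℝ) := by
  rw [Finset.sum_apply, HSK, Fintype.sum_prod_type]
  simp only [Finset.mul_sum, Pi.smul_apply, couplingDir, smul_eq_mul]
  refine Finset.sum_congr rfl fun i _ => Finset.sum_congr rfl fun j _ => ?_
  ring

theorem sum_couplingDir_mul {N : ℕ} (hN : 1 ≤ N) (β : ℝ) (σ ρ : Spins N) :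
    ∑ p, couplingDir N β p σ * couplingDir N β p ρ = N * β ^ 2 * overlap σ ρ ^ 2 := by
  have hN' : (0 : ℝ) < N := by positivity
  have h1 : ∀ p : Fin N × Fin N, couplingDir N β p σ * couplingDir N β p ρ =
      β ^ 2 / N * (((σ p.1 : ℝ) * ρ p.1) * ((σ p.2 : ℝ) * ρ p.2)) := by
    intro p
    unfold couplingDir
    have : (√(N : ℝ)) ^ 2 = N := sq_sqrt hN'.le
    field_simp
    rw [this]
    ring
  simp only [h1, Fintype.sum_prod_type, ← Finset.mul_sum, ← Finset.sum_mul]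
  unfold overlap
  field_simp

/-- Guerra's bound for finitely many levels. -/
theorem FSK_le_cavity {N : ℕ} (hN : 1 ≤ N) (β : ℝ) {q m : ℕ → ℝ} {k : ℕ} (hq0 : q 0 = 1)
    (hqk0 : q k = 0) (hq : ∀ j < k, q (j + 1) ≤ q j) (hqk : ∀ j ≤ k, 0 ≤ q j) (hm0 : m 0 = 1)
    (hm : ∀ j ≤ k, 0 < m j) (hm' : ∀ j < k, m (j + 1) ≤ m j)
    (hc : ∀ j x, 0 < cavity β q m j x) :
    FSK N β ≤ log (cavity β q m k 0) / m k - correction β q m k := by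
  have hN' : (0 : ℝ) < N := by positivity
  set ℓ := ContinuousLinearMap.snd ℝ ℝ ℝ
  have hℓ : ℓ (0, 1) = 1 := rfl
  have hmk := hm k le_rfl
  set Z : (Fin N × Fin N → ℝ) → ℝ := fun W =>
    ∑ σ : Spins N, exp (β * HSK N W fun i => (σ i : ℝ)) with hZ
  have hZ0 : ∀ W, 0 < Z W := fun W =>
    Finset.sum_pos (fun _ _ => exp_pos _) Finset.univ_nonempty
  have hZs : ∀ W, partFn ((0 : Spins N → ℝ) + ∑ p, W p • couplingDir N β p, (0, 1)) = Z W := by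
    intro W
    simp only [partFn, zero_add, sum_couplingDir, hZ]
  have hP : PosReg (partFn (V := Spins N)) := posReg_guerraLevel N β q m 0
  have iZ : ∀ θ : ℝ, Integrable (fun W => Z W ^ θ) (gaussW N) := by
    intro θ
    have := integrable_pi_shift (hP.rpow θ) hℓ (couplingDir N β) 0
    simpa only [hZs, gaussW] using this
  have hH := posReg_guerraLevel N β q m k
  have e1 : (∫ W, Z W ^ m k ∂(gaussW N)) * exp (m k * (N * correction β q m k)) =
      smooth ℓ (Finset.univ.toList.map (couplingDir N β)) (guerraLevel N β q m k) (0, 0, 1) := by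
    rw [← integral_pi_eq_smooth hH hℓ, gaussW]
    simp only [guerraLevel_zero_one β hm0 hq hqk hm k le_rfl, zero_add, sum_couplingDir]
    rw [integral_mul_const]
  have e2 : smooth ℓ (Finset.univ.toList.map (couplingDir N β)) (guerraLevel N β q m k) (0, 0, 1) ≤
      cavity β q m k 0 ^ N := by
    have h1 := (guerraFlow_guerraLevel hN β hq0 hq hqk hm hm' k le_rfl).smooth ℓ 1
      (fun c d => by simp [ℓ]) (Finset.univ.toList.map (couplingDir N β))
    refine (h1.le (fun σ ρ => ?_) 0).trans_eq ?_
    · rw [List.map_map, Finset.sum_map_toList]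
      simp only [Function.comp_apply, sum_couplingDir_mul hN, hqk0]
      ring
    · have h0 : (0 : Spins N → ℝ) = linField 0 := by ext σ; simp [linField]
      rw [smooth_of_eq_zero (by simp [ℓ]), h0,
        guerraLevel_linField N β q m (fun j x => (hc j x).le)]
      simp
  rw [← e1] at e2
  set a := ∫ W, Z W ^ m k ∂(gaussW N) with ha
  have : IsProbabilityMeasure (gaussW N) := by unfold gaussW; infer_instance
  have ha0 : 0 < a := by
    rw [ha, integral_pos_iff_support_of_nonneg (fun W => (rpow_pos_of_pos (hZ0 W) _).le) (iZ _)]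
    have : (Function.support fun W => Z W ^ m k) = Set.univ :=
      Set.eq_univ_of_forall fun W => (rpow_pos_of_pos (hZ0 W) _).ne'
    rw [this]; simp
  have hlog : log a ≤ N * log (cavity β q m k 0) - m k * (N * correction β q m k) := by
    have h1 := log_le_log (by positivity) e2
    rw [log_mul ha0.ne' (exp_pos _).ne', log_exp, log_pow] at h1
    linarith
  have ilog : Integrable (fun W => log (Z W)) (gaussW N) := by
    refine ((iZ 1).add (iZ (-1))).mono' ?_ (ae_of_all _ fun W => ?_)
    · have : Continuous Z := by simp only [hZ, HSK]; fun_prop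
      exact (this.log fun W => (hZ0 W).ne').aestronglyMeasurable
    · rw [norm_eq_abs, abs_le, Pi.add_apply, rpow_one, rpow_neg_one]
      have h1 := log_le_sub_one_of_pos (hZ0 W)
      have h2 := log_le_sub_one_of_pos (inv_pos.2 (hZ0 W))
      rw [log_inv] at h2
      have h3 := hZ0 W
      have h4 := inv_pos.2 (hZ0 W)
      constructor <;> linarith
  have hJ : m k * ∫ W, log (Z W) ∂(gaussW N) ≤ log a := by
    rw [← integral_const_mul]
    have h1 : ∀ W, m k * log (Z W) ≤ a⁻¹ * Z W ^ m k + (log a - 1) := by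
      intro W
      have hp := rpow_pos_of_pos (hZ0 W) (m k)
      have h2 := log_le_sub_one_of_pos (mul_pos (inv_pos.2 ha0) hp)
      rw [log_mul (inv_pos.2 ha0).ne' hp.ne', log_inv, log_rpow (hZ0 W)] at h2
      linarith
    refine (integral_mono (ilog.const_mul _)
      (((iZ _).const_mul _).add (integrable_const _)) h1).trans_eq ?_
    rw [integral_add' ((iZ _).const_mul _) (integrable_const _), integral_const_mul, ← ha,
      inv_mul_cancel₀ ha0.ne']
    simp
  have hF : FSK N β = 1 / N * ∫ W, log (Z W) ∂(gaussW N) := rfl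
  rw [hF, div_sub' hmk.ne', le_div_iff₀ hmk]
  have h3 := hJ.trans hlog
  rw [div_mul_eq_mul_div, div_mul_eq_mul_div, div_le_iff₀ hN']
  linarith

end Bound

section RealAnalysis

open Set Topology

theorem IsLocalMin.nonneg_of_hasDerivAt_hasDerivAt {f f' : ℝ → ℝ} {f'' x₀ : ℝ}
    (hmin : IsLocalMin f x₀) (hf : ∀ x, HasDerivAt f (f' x) x) (hf' : HasDerivAt f' f'' x₀) :
    0 ≤ f'' := by
  by_contra! hneg
  have hd : deriv f = f' := funext fun x => (hf x).deriv
  have hmax : IsLocalMax f x₀ := isLocalMax_of_deriv_deriv_neg (by rwa [hd, hf'.deriv])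
    hmin.deriv_eq_zero (hf x₀).continuousAt
  have hconst : f =ᶠ[𝓝 x₀] fun _ => f x₀ := by
    filter_upwards [hmin, hmax] with x h1 h2 using le_antisymm h2 h1
  have h0 : f' =ᶠ[𝓝 x₀] fun _ => 0 := by
    filter_upwards [hconst.eventuallyEq_nhds] with x hx
    rw [← hd, hx.deriv_eq, deriv_const]
  have := hf'.deriv
  rw [h0.deriv_eq, deriv_const] at this
  exact hneg.ne this.symm

/-- A continuous function that immediately decreases whenever it is negative, up to countably many
times, and that ends up nonnegative, was nonnegative all along. -/
theorem nonneg_of_eventually_lt {f : ℝ → ℝ} {a b : ℝ} (hab : a ≤ b) (hf : Continuous f)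
    (hb : 0 ≤ f b) {S : Set ℝ} (hS : S.Countable)
    (hdec : ∀ t ∈ Ioo a b \ S, f t < 0 → ∀ᶠ s in 𝓝[>] t, f s < f t) : 0 ≤ f a := by
  by_contra! ha
  obtain ⟨c, ⟨hac, hc0⟩, hcS⟩ : (Ioo (f a) 0 \ f '' S).Nonempty := by
    by_contra! hemp
    exact (Cardinal.Real.Ioo_countable_iff.not.2 ha.not_ge)
      ((hS.image f).mono (sdiff_eq_empty.1 hemp))
  have hT : IsCompact (Icc a b ∩ f ⁻¹' Iic c) :=
    isCompact_Icc.inter_right (isClosed_Iic.preimage hf)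
  obtain ⟨t, ⟨⟨hta, htb⟩, htc⟩, hmax⟩ := hT.exists_isMaxOn ⟨a, ⟨le_rfl, hab⟩, hac.le⟩
    continuousOn_id
  simp only [mem_preimage, mem_Iic] at htc
  have htb' : t < b := lt_of_le_of_ne htb (by rintro rfl; linarith)
  have hgt : ∀ s, t < s → s ≤ b → c < f s := by
    intro s hs hsb
    by_contra! h
    have := hmax ⟨⟨hta.trans hs.le, hsb⟩, h⟩
    exact absurd hs (not_lt.2 this)
  have hev : ∀ᶠ s in 𝓝[>] t, s < b := nhdsWithin_le_nhds (Iio_mem_nhds htb')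
  have htc' : f t = c := by
    refine le_antisymm htc (not_lt.1 fun hlt => ?_)
    have h1 : ∀ᶠ s in 𝓝[>] t, f s < c :=
      nhdsWithin_le_nhds (hf.continuousAt.eventually_lt_const hlt)
    obtain ⟨s, ⟨h2, h3⟩, h4⟩ := ((h1.and hev).and self_mem_nhdsWithin).exists
    exact absurd (hgt s h4 h3.le) h2.not_gt
  have hta' : a < t := lt_of_le_of_ne hta (by rintro rfl; linarith)
  have htS : t ∉ S := fun h => hcS ⟨t, h, htc'⟩
  obtain ⟨s, ⟨h2, h3⟩, h4⟩ := (((hdec t ⟨⟨hta', htb'⟩, htS⟩ (by linarith)).and hev).and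
    self_mem_nhdsWithin).exists
  exact absurd (hgt s h4 h3.le) (by rw [← htc']; exact h2.not_gt)

end RealAnalysis

section Heat

open Set Topology

theorem PosReg.heat {ψ : ℝ → ℝ} (hψ : PosReg fun X : ℝ × ℝ × ℝ => ψ X.1) (τ : ℝ) :
    PosReg fun X : ℝ × ℝ × ℝ => heat τ ψ X.1 := by
  have h1 := (hψ.gaussMom (ContinuousLinearMap.fst ℝ ℝ ℝ) 1).freeze (τ, 0)
  convert h1 using 2 with X
  rw [gaussMom_zero_apply]
  simp [_root_.heat]

theorem posReg_cavity (β : ℝ) (q m : ℕ → ℝ) (j : ℕ) :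
    PosReg fun X : ℝ × ℝ × ℝ => cavity β q m j X.1 := by
  induction j with
  | zero =>
    convert PosReg.sum_exp (E := ℝ) (fun b : Bool =>
      if b then ContinuousLinearMap.id ℝ ℝ else -ContinuousLinearMap.id ℝ ℝ) using 2 with X
    simp [cavity]
  | succ j ih => exact (ih.rpow _).heat _

/-- The Gaussian smoothing solves the heat equation with respect to the amplitude. -/
theorem exists_heat_flow {ψ : ℝ → ℝ} (hψ : PosReg fun X : ℝ × ℝ × ℝ => ψ X.1) :
    ∃ vc vx vxx : ℝ → ℝ → ℝ, Continuous (fun p : ℝ × ℝ => heat p.1 ψ p.2) ∧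
      (∀ R, ∃ C, 0 ≤ C ∧ ∀ c x, |c| ≤ R → heat c ψ x ≤ C * exp (C * |x|)) ∧
      ∀ c x, HasDerivAt (fun y => heat c ψ y) (vx c x) x ∧ HasDerivAt (vx c) (vxx c x) x ∧
        HasDerivAt (fun s => heat s ψ x) (vc c x) c ∧ vc c x = c * vxx c x := by
  set ℓ := ContinuousLinearMap.fst ℝ ℝ ℝ with hℓ
  set Ψ : ℝ × ℝ × ℝ → ℝ := fun X => ψ X.1 with hΨ
  set V := gaussMom 0 (shiftDir ℓ (1 : ℝ)) Ψ with hV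
  have hP : PosReg V := hψ.gaussMom ℓ 1
  have e : ∀ c x, heat c ψ x = V (x, c, 0) := by
    intro c x
    rw [hV, gaussMom_zero_apply]
    simp [heat, hΨ, hℓ]
  have hcont := hP.reg.continuous
  simp only [e]
  refine ⟨fun c x => fderiv ℝ V (x, c, 0) (0, 1, 0), fun c x => fderiv ℝ V (x, c, 0) (1, 0),
    fun c x => fderiv ℝ (fun Y => fderiv ℝ V Y (1, 0)) (x, c, 0) (1, 0), by fun_prop,
    fun R => ?_, fun c x => ⟨?_, ?_, ?_, ?_⟩⟩
  · obtain ⟨C, hC, hb⟩ := hP.reg.expBdd R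
    refine ⟨C, hC, fun c x hc => (le_abs_self _).trans (hb (x, c, 0) ?_)⟩
    simp [Prod.norm_def, hc]
  · have h1 : HasDerivAt (fun y : ℝ => (y, c, (0 : ℝ))) (1, 0) x :=
      (hasDerivAt_id x).prodMk (hasDerivAt_const x _)
    exact (hP.reg.hasFDerivAt _).comp_hasDerivAt x h1
  · have h1 : HasDerivAt (fun y : ℝ => (y, c, (0 : ℝ))) (1, 0) x :=
      (hasDerivAt_id x).prodMk (hasDerivAt_const x _)
    exact ((hP.reg.dir (1, 0)).hasFDerivAt _).comp_hasDerivAt x h1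
  · have h1 : HasDerivAt (fun y : ℝ => (x, y, (0 : ℝ))) (0, 1, 0) c :=
      (hasDerivAt_const c _).prodMk ((hasDerivAt_id c).prodMk (hasDerivAt_const c _))
    exact (hP.reg.hasFDerivAt _).comp_hasDerivAt c h1
  · have h0 : ∀ Y : ℝ × ℝ × ℝ, fderiv ℝ Ψ Y (0, 1, 0) = 0 := by
      intro Y
      have h1 : HasDerivAt (fun s : ℝ => Ψ (Y + s • (0, 1, 0))) (fderiv ℝ Ψ Y (0, 1, 0)) 0 := by
        have h2 : HasDerivAt (fun s : ℝ => Y + s • ((0, 1, 0) : ℝ × ℝ × ℝ)) (0, 1, 0) 0 := by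
          simpa using ((hasDerivAt_id (0 : ℝ)).smul_const ((0, 1, 0) : ℝ × ℝ × ℝ)).const_add Y
        have h4 : HasFDerivAt Ψ (fderiv ℝ Ψ Y) (Y + (0 : ℝ) • ((0, 1, 0) : ℝ × ℝ × ℝ)) := by
          simpa using hψ.reg.hasFDerivAt Y
        exact h4.comp_hasDerivAt 0 h2
      have h3 : (fun s : ℝ => Ψ (Y + s • (0, 1, 0))) = fun _ => Ψ Y := by
        ext s; simp [hΨ]
      rw [h3] at h1
      exact h1.unique (hasDerivAt_const _ _)
    simp only [hV]
    rw [fderiv_gaussMom_eq hψ.reg]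
    simp only [h0, integral_zero, zero_add, fderiv_gaussMom_space hψ.reg]
    rw [fderiv_gaussMom_space (hψ.reg.dir _), gaussMom_zero_apply]
    simp [hℓ]

end Heat

section Comparison

open Set Topology

/-- Comparison of a nonnegative supersolution of the backward heat equation with the Gaussian
smoothing of its terminal value. -/
theorem heat_le_of_supersolution {β : ℝ} (hβ : 0 ≤ β) {ψ : ℝ → ℝ}
    (hψ : PosReg fun X : ℝ × ℝ × ℝ => ψ X.1) {a b : ℝ} (hab : a ≤ b) {S : Set ℝ}
    (hS : S.Countable) {Θ : ℝ → ℝ → ℝ}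
    (hΘc : ContinuousOn (fun p : ℝ × ℝ => Θ p.1 p.2) (Icc a b ×ˢ univ))
    (hΘ0 : ∀ t ∈ Icc a b, ∀ x, 0 ≤ Θ t x)
    (hΘ : ∀ t ∈ Ioo a b \ S, ∀ x, ∃ (Θx : ℝ → ℝ) (Θt Θxx : ℝ),
      (∀ y, HasDerivAt (Θ t) (Θx y) y) ∧ HasDerivAt Θx Θxx x ∧ HasDerivAt (fun s => Θ s x) Θt t ∧
        Θt + β ^ 2 * Θxx ≤ 0)
    (hb : ∀ x, ψ x ≤ Θ b x) (x₀ : ℝ) : heat (√(2 * β ^ 2 * (b - a))) ψ x₀ ≤ Θ a x₀ := by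
  obtain ⟨vc, vx, vxx, hvcont, hvgrow, hv⟩ := exists_heat_flow hψ
  set c : ℝ → ℝ := fun t => β * √(2 * (b - t)) with hc
  have hca : √(2 * β ^ 2 * (b - a)) = c a := by
    rw [hc, show 2 * β ^ 2 * (b - a) = β ^ 2 * (2 * (b - a)) by ring, sqrt_mul (sq_nonneg β),
      sqrt_sq hβ]
  have hc0 : ∀ t, 0 ≤ c t := fun t => by positivity
  have hcc : Continuous c := by fun_prop
  obtain ⟨D, hD, hgrow⟩ := hvgrow (c a)
  have hgrow' : ∀ t ∈ Icc a b, ∀ x, heat (c t) ψ x ≤ D * exp (D * |x|) := by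
    intro t ht x
    refine hgrow _ _ ?_
    rw [abs_of_nonneg (hc0 t)]
    have : √(2 * (b - t)) ≤ √(2 * (b - a)) := sqrt_le_sqrt (by linarith [ht.1])
    exact mul_le_mul_of_nonneg_left this hβ
  have hcd : ∀ t < b, ∃ c', HasDerivAt c c' t ∧ c t * c' = -β ^ 2 := by
    intro t ht
    have hpos : 0 < 2 * (b - t) := by linarith
    have h1 : HasDerivAt (fun t => 2 * (b - t)) (2 * (-1)) t := by
      simpa using ((hasDerivAt_id t).const_sub b).const_mul 2
    refine ⟨_, (h1.sqrt hpos.ne').const_mul β, ?_⟩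
    have := (sqrt_pos.2 hpos).ne'
    simp only [hc]
    field_simp
  set lam := D + 1 with hlam
  set κ := β ^ 2 * lam ^ 2 + 1 with hκ
  have main : ∀ ε > 0, ∀ x, 0 ≤ Θ a x + ε * exp (κ * (b - a)) * cosh (lam * x) - heat (c a) ψ x := by
    intro ε hε x₁
    set u : ℝ → ℝ → ℝ := fun t x => Θ t x + ε * exp (κ * (b - t)) * cosh (lam * x) - heat (c t) ψ x
      with hu
    have hκ0 : 0 < κ := by positivity
    have hbig : ∀ t ∈ Icc a b, ∀ x, 2 * D / ε ≤ |x| → 0 < u t x := by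
      intro t ht x hx
      have h1 := hΘ0 t ht x
      have h2 := hgrow' t ht x
      have h3 : exp ((D + 1) * |x|) ≤ 2 * cosh (lam * x) := by
        rw [← cosh_abs, abs_mul, abs_of_pos (by positivity : 0 < lam), cosh_eq, hlam]
        linarith [exp_pos (-((D + 1) * |x|))]
      have h4 : 2 * D < ε * exp |x| := by
        rw [div_le_iff₀ hε] at hx
        nlinarith [add_one_le_exp |x|]
      have h5 : 2 * (D * exp (D * |x|)) < ε * exp ((D + 1) * |x|) := by
        rw [add_mul, one_mul, exp_add]
        nlinarith [exp_pos (D * |x|)]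
      have h6 : 1 ≤ exp (κ * (b - t)) :=
        one_le_exp (mul_nonneg hκ0.le (sub_nonneg.2 ht.2))
      have h7 : ε * cosh (lam * x) ≤ ε * exp (κ * (b - t)) * cosh (lam * x) := by
        rw [mul_right_comm]
        exact le_mul_of_one_le_right (mul_nonneg hε.le (cosh_pos _).le) h6
      simp only [hu]
      nlinarith
    by_cases hx₁ : 2 * D / ε ≤ |x₁|
    · exact (hbig a ⟨le_rfl, hab⟩ x₁ hx₁).le
    push Not at hx₁
    set R := 2 * D / ε
    have hR : 0 ≤ R := by positivity
    set u' : ℝ → ℝ → ℝ := fun t x => u (projIcc a b hab t) x with hu'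
    have hu'c : Continuous fun p : ℝ × ℝ => u' p.1 p.2 := by
      have hp : Continuous fun p : ℝ × ℝ => ((projIcc a b hab p.1 : ℝ), p.2) := by fun_prop
      have h1 : Continuous fun p : ℝ × ℝ => Θ (projIcc a b hab p.1) p.2 :=
        hΘc.comp_continuous hp fun p => ⟨(projIcc a b hab p.1).2, mem_univ _⟩
      have h2 : Continuous fun p : ℝ × ℝ => heat (c (projIcc a b hab p.1)) ψ p.2 :=
        hvcont.comp (((hcc.comp continuous_fst).comp hp).prodMk continuous_snd)
      have h3 : Continuous fun p : ℝ × ℝ => ε * exp (κ * (b - (projIcc a b hab p.1 : ℝ))) *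
          cosh (lam * p.2) := by fun_prop
      exact (h1.add h3).sub h2
    have hu't : ∀ t ∈ Icc a b, ∀ x, u' t x = u t x := by
      intro t ht x
      simp only [hu', projIcc_of_mem hab ht]
    set n : ℝ → ℝ := fun t => sInf (u' t '' Icc (-R) R) with hn
    have hncont : Continuous n := isCompact_Icc.continuous_sInf hu'c
    have hslice : ∀ t, Continuous (u' t) := fun t =>
      hu'c.comp (Continuous.prodMk continuous_const continuous_id)
    have hbdd : ∀ t, BddBelow (u' t '' Icc (-R) R) := fun t =>
      (isCompact_Icc.image (hslice t)).bddBelow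
    have hne : (Icc (-R) R).Nonempty := ⟨0, by simpa using hR⟩
    have hnle : ∀ t, ∀ x ∈ Icc (-R) R, n t ≤ u' t x := fun t x hx =>
      csInf_le (hbdd t) (mem_image_of_mem _ hx)
    have hnmin : ∀ t, ∃ x ∈ Icc (-R) R, u' t x = n t := fun t =>
      (isCompact_Icc.image (hslice t)).sInf_mem (hne.image _)
    have hfin : 0 ≤ n a := by
      refine nonneg_of_eventually_lt hab hncont ?_ hS fun t ht hneg => ?_
      · obtain ⟨x, -, hx⟩ := hnmin b
        rw [← hx, hu't b ⟨hab, le_rfl⟩]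
        have h1 : heat (c b) ψ x = ψ x := by simp [heat, hc]
        simp only [hu, h1]
        have h2 : 0 ≤ ε * exp (κ * (b - b)) * cosh (lam * x) :=
          mul_nonneg (mul_nonneg hε.le (exp_pos _).le) (cosh_pos _).le
        linarith [hb x]
      · have htI : t ∈ Icc a b := Ioo_subset_Icc_self ht.1
        obtain ⟨x, hxR, hx⟩ := hnmin t
        have hxR' : |x| < R := by
          by_contra! h
          have := hbig t htI x h
          rw [← hu't t htI, hx] at this
          linarith
        have hmin : IsLocalMin (u t) x := by
          have : Icc (-R) R ∈ 𝓝 x := Icc_mem_nhds (abs_lt.1 hxR').1 (abs_lt.1 hxR').2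
          filter_upwards [this] with y hy
          rw [← hu't t htI, ← hu't t htI, hx]
          exact hnle t y hy
        obtain ⟨Θx, Θt, Θxx, hΘx, hΘxx, hΘt, hle⟩ := hΘ t ht x
        obtain ⟨c', hc', hcc'⟩ := hcd t ht.1.2
        set P := ε * exp (κ * (b - t)) with hP
        have hP0 : 0 < P := by positivity
        have hlin : ∀ y : ℝ, HasDerivAt (fun y => lam * y) lam y := fun y => by
          simpa using (hasDerivAt_id y).const_mul lam
        have hux : ∀ y, HasDerivAt (u t)
            (Θx y + P * (sinh (lam * y) * lam) - vx (c t) y) y := fun y =>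
          ((hΘx y).add ((hlin y).cosh.const_mul P)).sub (hv (c t) y).1
        have huxx : HasDerivAt (fun y => Θx y + P * (sinh (lam * y) * lam) - vx (c t) y)
            (Θxx + P * (cosh (lam * x) * lam * lam) - vxx (c t) x) x :=
          (hΘxx.add (((hlin x).sinh.mul_const lam).const_mul P)).sub (hv (c t) x).2.1
        have hut : HasDerivAt (fun s => u s x)
            (Θt + -κ * (P * cosh (lam * x)) - vc (c t) x * c') t := by
          have h1 : HasDerivAt (fun s => κ * (b - s)) (κ * (-1)) t := by
            simpa using ((hasDerivAt_id t).const_sub b).const_mul κ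
          have h2 : HasDerivAt (fun s => ε * exp (κ * (b - s)) * cosh (lam * x))
              (-κ * (P * cosh (lam * x))) t :=
            ((h1.exp.const_mul ε).mul_const _).congr_deriv (by rw [hP]; ring)
          exact (hΘt.add h2).sub (((hv (c t) x).2.2.1).comp t hc')
        have hsec := hmin.nonneg_of_hasDerivAt_hasDerivAt hux huxx
        have hneg' : Θt + -κ * (P * cosh (lam * x)) - vc (c t) x * c' < 0 := by
          have e1 : vc (c t) x * c' = -β ^ 2 * vxx (c t) x := by
            rw [(hv (c t) x).2.2.2, ← hcc']; ring
          have e2 := mul_nonneg (sq_nonneg β) hsec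
          have e3 : 0 < P * cosh (lam * x) := mul_pos hP0 (cosh_pos _)
          rw [e1, hκ]
          nlinarith
        have hslope := (hasDerivWithinAt_iff_tendsto_slope' (self_notMem_Ioi (a := t))).1
          (hut.hasDerivWithinAt (s := Ioi t))
        have htb : ∀ᶠ s in 𝓝[>] t, s < b := nhdsWithin_le_nhds (Iio_mem_nhds ht.1.2)
        filter_upwards [hslope.eventually_lt_const hneg', htb, self_mem_nhdsWithin] with s h1 h2 h3
        have h3' : t < s := h3
        have h4 : u s x < u t x := by
          rw [slope_def_field, div_lt_iff₀ (sub_pos.2 h3')] at h1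
          linarith
        calc n s ≤ u' s x := hnle s x hxR
          _ = u s x := hu't s ⟨ht.1.1.le.trans h3'.le, h2.le⟩ x
          _ < u t x := h4
          _ = n t := by rw [← hx, hu't t htI]
    have h1 := hnle a x₁ (abs_le.1 hx₁.le)
    rw [hu't a ⟨le_rfl, hab⟩] at h1
    exact hfin.trans h1
  rw [hca]
  refine le_of_forall_pos_le_add fun δ hδ => ?_
  have hp : 0 < exp (κ * (b - a)) * cosh (lam * x₀) := mul_pos (exp_pos _) (cosh_pos _)
  have h1 := main (δ / (exp (κ * (b - a)) * cosh (lam * x₀))) (div_pos hδ hp) x₀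
  rw [mul_assoc, div_mul_cancel₀ _ hp.ne'] at h1
  linarith

end Comparison

section Parisi

theorem monotone_measure_Icc (μ : Measure ℝ) [IsProbabilityMeasure μ] :
    Monotone fun s : ℝ => (μ (Set.Icc 0 s)).toReal := fun _ _ h =>
  ENNReal.toReal_mono (measure_ne_top _ _) (measure_mono (Set.Icc_subset_Icc_right h))

theorem countable_atomSet (μ : Measure ℝ) [IsProbabilityMeasure μ] : (atomSet μ).Countable := by
  have := Measure.countable_meas_pos_of_disjoint_iUnion (μ := μ) (As := fun t : ℝ => {t})
    (fun t => measurableSet_singleton t) fun s t hst => Set.disjoint_singleton.2 hst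
  simpa only [atomSet, pos_iff_ne_zero] using this

/-- One level of the comparison between the one-site recursion and the Parisi PDE. -/
theorem ParisiAdmissible.heat_le {β : ℝ} (hβ : 0 ≤ β) {μ : Measure ℝ} [IsProbabilityMeasure μ]
    {Φ : ℝ → ℝ → ℝ} (hΦ : ParisiAdmissible β μ Φ) :
    ∃ C : ℝ, ∀ {ψ : ℝ → ℝ} {a b m δ : ℝ}, PosReg (fun X : ℝ × ℝ × ℝ => ψ X.1) → 0 ≤ a → a ≤ b →
      b ≤ 1 → 0 ≤ m → 0 ≤ δ → m ≤ (μ (Set.Icc 0 a)).toReal + δ →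
      (∀ x, ψ x ≤ exp (m * (Φ b x + log 2 + β ^ 2 * C ^ 2 * δ * (1 - b)))) →
      ∀ x, heat (√(2 * β ^ 2 * (b - a))) ψ x ≤
        exp (m * (Φ a x + log 2 + β ^ 2 * C ^ 2 * δ * (1 - a))) := by
  obtain ⟨hcont, -, Φx, Φt, Φxx, C, hx, -, hC, hd, -, -, hpde⟩ := hΦ
  refine ⟨C, fun {ψ a b m δ} hψ ha hab hb hm hδ hmF hψb => ?_⟩
  set η := β ^ 2 * C ^ 2 * δ with hη
  set F : ℝ → ℝ := fun s => (μ (Set.Icc 0 s)).toReal with hF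
  have hFm : Monotone F := monotone_measure_Icc μ
  refine heat_le_of_supersolution hβ hψ hab
    (S := atomSet μ ∪ {t | ¬ContinuousAt F t})
    ((countable_atomSet μ).union hFm.countable_not_continuousAt)
    (Θ := fun t x => exp (m * (Φ t x + log 2 + η * (1 - t)))) ?_ (fun _ _ _ => (exp_pos _).le)
    (fun t ht x => ?_) hψb
  · have : ContinuousOn (fun p : ℝ × ℝ => Φ p.1 p.2) (Set.Icc a b ×ˢ Set.univ) :=
      hcont.mono (Set.prod_mono_left (Set.Icc_subset_Icc ha hb))
    fun_prop
  · have ht1 : t ∈ Set.Ioo (0 : ℝ) 1 := ⟨ha.trans_lt ht.1.1, ht.1.2.trans_le hb⟩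
    have htA : t ∉ atomSet μ := fun h => ht.2 (Or.inl h)
    have htc : ContinuousAt F t := by
      by_contra h
      exact ht.2 (Or.inr h)
    obtain ⟨hdt, hdx⟩ := hd (t, x) ⟨⟨ht1, htA⟩, trivial⟩
    have hxt := hx t (Set.Ioo_subset_Icc_self ht1)
    have hCt := hC t (Set.Ioo_subset_Icc_self ht1) x
    have hp := hpde t ht1 htc x
    have hmt : m ≤ F t + δ := hmF.trans (by gcongr; exact hFm ht.1.1.le)
    have h1 : ∀ y, HasDerivAt (fun y => exp (m * (Φ t y + log 2 + η * (1 - t))))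
        (exp (m * (Φ t y + log 2 + η * (1 - t))) * (m * Φx t y)) y := fun y =>
      ((((hxt y).add_const (log 2)).add_const _).const_mul m).exp
    have h2 := (h1 x).mul (hdx.const_mul m)
    have h3 : HasDerivAt (fun s => η * (1 - s)) (η * (-1)) t := by
      simpa using ((hasDerivAt_id t).const_sub 1).const_mul η
    have h4 := (((hdt.add_const (log 2)).add h3).const_mul m).exp
    refine ⟨_, _, _, h1, h2, h4, ?_⟩
    simp only [Pi.add_apply]
    set θ := exp (m * (Φ t x + log 2 + η * (1 - t))) with hθ
    have hθ0 : 0 < θ := exp_pos _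
    have hsq : Φx t x ^ 2 ≤ C ^ 2 := sq_le_sq' (abs_le.1 hCt).1 (abs_le.1 hCt).2
    have hmain : β ^ 2 * ((m - F t) * Φx t x ^ 2) ≤ η := by
      rw [hη, mul_assoc]
      refine mul_le_mul_of_nonneg_left ?_ (sq_nonneg β)
      rcases le_total (m - F t) 0 with h | h
      · exact (mul_nonpos_of_nonpos_of_nonneg h (sq_nonneg _)).trans (by positivity)
      · nlinarith [sq_nonneg (Φx t x)]
    have e : θ * (m * (Φt t x + η * (-1))) + β ^ 2 * (θ * (m * Φx t x) * (m * Φx t x) +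
        θ * (m * Φxx t x)) = θ * m * (β ^ 2 * ((m - F t) * Φx t x ^ 2) - η) := by
      linear_combination (-θ * m) * hp
    rw [e]
    exact mul_nonpos_of_nonneg_of_nonpos (mul_nonneg hθ0.le hm) (by linarith)

theorem ParisiAdmissible.cavity_le {β : ℝ} (hβ : 0 ≤ β) {μ : Measure ℝ} [IsProbabilityMeasure μ]
    {Φ : ℝ → ℝ → ℝ} (hΦ : ParisiAdmissible β μ Φ) :
    ∃ C : ℝ, ∀ {q m : ℕ → ℝ} {k : ℕ} {δ : ℝ}, q 0 = 1 → (∀ j < k, q (j + 1) ≤ q j) →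
      (∀ j ≤ k, 0 ≤ q j) → (∀ j ≤ k, q j ≤ 1) → m 0 = 1 → (∀ j ≤ k, 0 < m j) → 0 ≤ δ →
      (∀ j ≤ k, m j ≤ (μ (Set.Icc 0 (q j))).toReal + δ) →
      ∀ j ≤ k, ∀ x, cavity β q m j x ≤
        exp (m j * (Φ (q j) x + log 2 + β ^ 2 * C ^ 2 * δ * (1 - q j))) := by
  obtain ⟨C, hC⟩ := hΦ.heat_le hβ
  refine ⟨C, fun {q m k δ} hq0 hq hqk hq1 hm0 hm hδ hmF j => ?_⟩
  induction j with
  | zero =>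
    intro _ x
    rw [hq0, hm0, hΦ.2.1 x, one_mul, sub_self, mul_zero, add_zero, exp_add,
      exp_log (cosh_pos x), exp_log two_pos, cosh_eq]
    simp [cavity]
  | succ j ih =>
    intro hj x
    have hmj := hm j (by omega)
    refine hC ((posReg_cavity β q m j).rpow _) (hqk _ hj) (hq j hj) (hq1 j (by omega))
      (hm _ hj).le hδ (hmF _ hj) (fun x => ?_) x
    refine (rpow_le_rpow ((posReg_cavity β q m j).pos (x, 0, 0)).le (ih (by omega) x)
      (div_nonneg (hm _ hj).le hmj.le)).trans_eq ?_
    rw [← exp_mul]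
    congr 1
    field_simp

theorem integral_le_correction (β : ℝ) {μ : Measure ℝ} [IsProbabilityMeasure μ]
    {q m : ℕ → ℝ} {k : ℕ} {δ : ℝ} (hq0 : q 0 = 1) (hq : ∀ j < k, q (j + 1) ≤ q j)
    (hqk : ∀ j ≤ k, 0 ≤ q j) (hq1 : ∀ j ≤ k, q j ≤ 1) (hqδ : ∀ j < k, q j - q (j + 1) ≤ δ)
    (hm : ∀ j ≤ k, (μ (Set.Icc 0 (q j))).toReal ≤ m j) (j : ℕ) (hj : j ≤ k) :
    β ^ 2 * ∫ t in (q j)..1, t * (μ (Set.Icc 0 t)).toReal ≤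
      correction β q m j +
        β ^ 2 * δ * ((μ (Set.Icc 0 1)).toReal - (μ (Set.Icc 0 (q j))).toReal) := by
  set F : ℝ → ℝ := fun s => (μ (Set.Icc 0 s)).toReal with hF
  have hFm : Monotone F := monotone_measure_Icc μ
  have hint : ∀ a b : ℝ, IntervalIntegrable (fun t => t * F t) volume a b := fun a b =>
    hFm.intervalIntegrable.continuousOn_mul continuousOn_id
  change β ^ 2 * ∫ t in (q j)..1, t * F t ≤ correction β q m j + β ^ 2 * δ * (F 1 - F (q j))
  induction j with
  | zero => simp [hq0, correction]
  | succ j ih =>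
    have hle := hq j hj
    have h0 := hqk _ hj
    have h1 := hq1 j (by omega)
    have hstep : ∫ t in (q (j + 1))..(q j), t * F t ≤
        F (q j) * ((q j ^ 2 - q (j + 1) ^ 2) / 2) := by
      rw [← integral_id, ← intervalIntegral.integral_const_mul]
      refine intervalIntegral.integral_mono_on hle (hint _ _)
        (Continuous.intervalIntegrable (by fun_prop) _ _) fun t ht => ?_
      rw [mul_comm]
      exact mul_le_mul_of_nonneg_right (hFm ht.2) (h0.trans ht.1)
    have hsq : (q j ^ 2 - q (j + 1) ^ 2) / 2 ≤ δ := by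
      nlinarith [hqδ j hj]
    have hsq0 : 0 ≤ (q j ^ 2 - q (j + 1) ^ 2) / 2 := by nlinarith
    have hΔ : (F (q j) - F (q (j + 1))) * ((q j ^ 2 - q (j + 1) ^ 2) / 2) ≤
        (F (q j) - F (q (j + 1))) * δ :=
      mul_le_mul_of_nonneg_left hsq (sub_nonneg.2 (hFm hle))
    have hmm := mul_le_mul_of_nonneg_right (hm _ hj) hsq0
    have htot : ∫ t in (q (j + 1))..(q j), t * F t ≤
        m (j + 1) * ((q j ^ 2 - q (j + 1) ^ 2) / 2) + (F (q j) - F (q (j + 1))) * δ := by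
      linarith
    have hβ := mul_le_mul_of_nonneg_left htot (sq_nonneg β)
    have hih := ih (by omega)
    rw [← intervalIntegral.integral_add_adjacent_intervals (hint _ (q j)) (hint _ _),
      correction, Finset.sum_range_succ, ← correction]
    linarith

end Parisi

/-- Guerra's upper bound: for every `β ≥ 0`, every Borel probability measure `μ` on `[0,1]`,
every admissible solution `Φ` of the associated Parisi PDE, and every `N ≥ 1`,
`F_N(β) ≤ Φ(0,0) − β² ∫₀¹ t μ([0,t]) dt + log 2`. -/
theorem guerra_upper_bound (β : ℝ) (hβ : 0 ≤ β) (μ : Measure ℝ)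
    (hμ : IsProbabilityMeasure μ) (hsupp : μ (Set.Icc 0 1)ᶜ = 0)
    (Φ : ℝ → ℝ → ℝ) (hΦ : ParisiAdmissible β μ Φ) (N : ℕ) (hN : 1 ≤ N) :
    FSK N β ≤
      Φ 0 0 - β ^ 2 * (∫ t in (0 : ℝ)..1, t * (μ (Set.Icc 0 t)).toReal) + Real.log 2 := by
  obtain ⟨C, hC⟩ := hΦ.cavity_le hβ
  set F : ℝ → ℝ := fun s => (μ (Set.Icc 0 s)).toReal with hF
  have hFm : Monotone F := monotone_measure_Icc μ
  have hF1 : F 1 = 1 := by simp [hF, (prob_compl_eq_zero_iff measurableSet_Icc).1 hsupp]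
  have key : ∀ n : ℕ, FSK N β ≤ (Φ 0 0 - β ^ 2 * (∫ t in (0 : ℝ)..1, t * F t) + log 2) +
      (β ^ 2 * C ^ 2 + β ^ 2) * (1 / ((n : ℝ) + 1)) := by
    intro n
    set δ : ℝ := 1 / ((n : ℝ) + 1) with hδ
    have hδ0 : 0 < δ := by positivity
    have hδ1 : δ ≤ 1 := by rw [hδ, div_le_one (by positivity)]; linarith [n.cast_nonneg (α := ℝ)]
    have hnδ : ((n + 1 : ℕ) : ℝ) * δ = 1 := by rw [hδ]; push_cast; field_simp
    set q : ℕ → ℝ := fun j => 1 - j * δ with hqd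
    set m : ℕ → ℝ := fun j => max (F (q j)) δ with hmd
    have hq0 : q 0 = 1 := by simp [hqd]
    have hqn : q (n + 1) = 0 := by simp only [hqd, hnδ, sub_self]
    have hdiff : ∀ j, q j - q (j + 1) = δ := fun j => by simp only [hqd]; push_cast; ring
    have hq : ∀ j < n + 1, q (j + 1) ≤ q j := fun j _ => by linarith [hdiff j]
    have hqk : ∀ j ≤ n + 1, 0 ≤ q j := fun j hj => by
      have : (j : ℝ) * δ ≤ ((n + 1 : ℕ) : ℝ) * δ := by gcongr
      simp only [hqd]
      linarith
    have hq1 : ∀ j ≤ n + 1, q j ≤ 1 := fun j _ => by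
      have : 0 ≤ (j : ℝ) * δ := by positivity
      simp only [hqd]
      linarith
    have hm0 : m 0 = 1 := by simp [hmd, hq0, hF1, hδ1]
    have hm : ∀ j ≤ n + 1, 0 < m j := fun j _ => lt_max_of_lt_right hδ0
    have hm' : ∀ j < n + 1, m (j + 1) ≤ m j := fun j hj =>
      max_le_max (hFm (hq j hj)) le_rfl
    have hmF : ∀ j ≤ n + 1, m j ≤ F (q j) + δ := fun j _ =>
      max_le (by linarith) (by linarith [show 0 ≤ F (q j) from ENNReal.toReal_nonneg])
    have hcpos : ∀ j x, 0 < cavity β q m j x := fun j x => (posReg_cavity β q m j).pos (x, 0, 0)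
    have h1 := FSK_le_cavity hN β hq0 hqn hq hqk hm0 hm hm' hcpos
    have h2 := hC hq0 hq hqk hq1 hm0 hm hδ0.le hmF (n + 1) le_rfl 0
    have h3 := integral_le_correction β (μ := μ) (m := m) hq0 hq hqk hq1 (fun j _ => (hdiff j).le)
      (fun j _ => le_max_left _ _) (n + 1) le_rfl
    have h4 := (log_le_iff_le_exp (hcpos _ _)).2 h2
    rw [← div_le_iff₀' (hm _ le_rfl)] at h4
    rw [hqn] at h3 h4
    change β ^ 2 * ∫ t in (0 : ℝ)..1, t * F t ≤ correction β q m (n + 1) +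
      β ^ 2 * δ * (F 1 - F 0) at h3
    have h5 : β ^ 2 * δ * (F 1 - F 0) ≤ β ^ 2 * δ := by
      rw [hF1]
      exact mul_le_of_le_one_right (by positivity)
        (by linarith [show 0 ≤ F 0 from ENNReal.toReal_nonneg])
    linarith
  have hlim := (tendsto_one_div_add_atTop_nhds_zero_nat (𝕜 := ℝ)).const_mul
    (β ^ 2 * C ^ 2 + β ^ 2) |>.const_add
      (Φ 0 0 - β ^ 2 * (∫ t in (0 : ℝ)..1, t * F t) + log 2)
  rw [mul_zero, add_zero] at hlim
  exact ge_of_tendsto' hlim key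
end

section
/- The normalized expected ground-state energy N^{-1} E[max_{σ∈{-1,1}^N} H_N(σ)] of the Sherrington–Kirkpatrick model converges as N → ∞. -/
open MeasureTheory ProbabilityTheory Real Filter
open scoped NNReal

theorem hasDerivAt_gaussianPDFReal_std (x : ℝ) :
    HasDerivAt (gaussianPDFReal 0 1) (-(x * gaussianPDFReal 0 1 x)) x := by
  rw [gaussianPDFReal_def]
  have h : HasDerivAt (fun y : ℝ => -(y - 0) ^ 2 / (2 * ((1 : ℝ≥0) : ℝ))) (-x) x := by
    have := (((hasDerivAt_id x).sub_const 0).pow 2).neg.div_const (2 * ((1 : ℝ≥0) : ℝ))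
    refine this.congr_deriv ?_
    simp only [id, Nat.cast_ofNat, NNReal.coe_one]
    ring
  refine (h.exp.const_mul ((√(2 * π * ((1 : ℝ≥0) : ℝ)))⁻¹)).congr_deriv ?_
  ring

theorem integrable_id_gaussianReal_std : Integrable (fun y : ℝ => y) (gaussianReal 0 1) :=
  (memLp_id_gaussianReal (μ := 0) (v := 1) 1).integrable (by norm_num)

/-- Gaussian integration by parts on the line. -/
theorem integral_mul_gaussianReal_std {f f' : ℝ → ℝ} {C : ℝ}
    (hf : ∀ x, HasDerivAt f (f' x) x) (hf'm : Measurable f')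
    (hb : ∀ x, |f x| ≤ C) (hb' : ∀ x, |f' x| ≤ C) :
    ∫ y, y * f y ∂(gaussianReal 0 1) = ∫ y, f' y ∂(gaussianReal 0 1) := by
  have hfc : Continuous f := continuous_iff_continuousAt.2 fun x => (hf x).continuousAt
  have hpdf := integrable_gaussianPDFReal 0 1
  have hxpdf : Integrable (fun x => x * gaussianPDFReal 0 1 x) volume := by
    have := (integrable_mul_exp_neg_mul_sq (b := 1 / 2) (by norm_num)).const_mul
      ((√(2 * π * ((1 : ℝ≥0) : ℝ)))⁻¹)
    convert this using 2 with x
    rw [gaussianPDFReal_def]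
    have : -(x - 0) ^ 2 / (2 * ((1 : ℝ≥0) : ℝ)) = -(1 / 2) * x ^ 2 := by
      simp; ring
    simp only [this]
    ring
  have key := integral_mul_deriv_eq_deriv_mul_of_integrable (u := f) (u' := f')
    (v := gaussianPDFReal 0 1) (v' := fun x => -(x * gaussianPDFReal 0 1 x))
    (fun x _ => hf x) (fun x _ => hasDerivAt_gaussianPDFReal_std x)
    (hxpdf.neg.bdd_mul hfc.aestronglyMeasurable (ae_of_all _ hb))
    (hpdf.bdd_mul hf'm.aestronglyMeasurable (ae_of_all _ hb'))
    (hpdf.bdd_mul hfc.aestronglyMeasurable (ae_of_all _ hb))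
  rw [integral_gaussianReal_eq_integral_smul one_ne_zero,
    integral_gaussianReal_eq_integral_smul one_ne_zero]
  simp only [mul_neg, integral_neg, neg_inj] at key
  simp only [smul_eq_mul]
  calc ∫ x, gaussianPDFReal 0 1 x * (x * f x)
      = ∫ x, f x * (x * gaussianPDFReal 0 1 x) := by congr 1 with x; ring
    _ = ∫ x, f' x * gaussianPDFReal 0 1 x := key
    _ = ∫ x, gaussianPDFReal 0 1 x * f' x := by congr 1 with x; ring

section Pi

variable {ι : Type*} [Fintype ι]

theorem measurePreserving_update_pi [DecidableEq ι] (μ : ι → Measure ℝ)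
    [∀ i, IsProbabilityMeasure (μ i)] (i : ι) :
    MeasurePreserving (fun p : (ι → ℝ) × ℝ => Function.update p.1 i p.2)
      ((Measure.pi μ).prod (μ i)) (Measure.pi μ) := by
  have hm : Measurable (fun p : (ι → ℝ) × ℝ => Function.update p.1 i p.2) := by
    refine measurable_pi_iff.2 fun j => ?_
    by_cases h : j = i
    · subst h; simpa using measurable_snd
    · simpa [h] using measurable_fst.eval
  refine ⟨hm, (Measure.pi_eq fun s hs => ?_).symm⟩
  rw [Measure.map_apply hm (MeasurableSet.univ_pi hs)]
  have : (fun p : (ι → ℝ) × ℝ => Function.update p.1 i p.2) ⁻¹' (Set.univ.pi s)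
      = (Set.univ.pi (Function.update s i Set.univ)) ×ˢ s i := by
    ext ⟨w, y⟩
    simp only [Set.mem_preimage, Set.mem_pi, Set.mem_univ, true_imp_iff, Set.mem_prod]
    constructor
    · intro h
      refine ⟨fun j => ?_, by simpa using h i⟩
      by_cases hj : j = i
      · subst hj; simp
      · simpa [hj] using h j
    · rintro ⟨h, hy⟩ j
      by_cases hj : j = i
      · subst hj; simpa using hy
      · simpa [hj] using h j
  rw [this, Measure.prod_prod, Measure.pi_pi, ← Finset.mul_prod_erase _ _ (Finset.mem_univ i),
    ← Finset.mul_prod_erase _ (fun j => μ j (s j)) (Finset.mem_univ i)]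
  simp only [Function.update_self, measure_univ, one_mul]
  rw [mul_comm]
  congr 1
  refine Finset.prod_congr rfl fun j hj => ?_
  rw [Function.update_of_ne (Finset.ne_of_mem_erase hj)]

theorem measurePreserving_precomp_pi {κ : Type*} [Fintype κ] (μ : Measure ℝ)
    [IsProbabilityMeasure μ] {e : κ → ι} (he : e.Injective) :
    MeasurePreserving (fun (w : ι → ℝ) k => w (e k)) (Measure.pi fun _ => μ)
      (Measure.pi fun _ => μ) := by
  refine ⟨by fun_prop, ?_⟩
  have h : iIndepFun (fun i (w : ι → ℝ) => w i) (Measure.pi fun _ => μ) :=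
    iIndepFun_pi (X := fun _ x => x) fun _ => aemeasurable_id
  rw [(iIndepFun_iff_map_fun_eq_pi_map (fun k => (measurable_pi_apply (e k)).aemeasurable)).1 (h.precomp he)]
  congr 1
  ext1 k
  exact (measurePreserving_eval (fun _ : ι => μ) (e k)).map_eq

/-- The law of a family of independent standard Gaussian variables. -/
noncomputable def stdGaussianPi (ι : Type*) [Fintype ι] : Measure (ι → ℝ) :=
  Measure.pi fun _ => gaussianReal 0 1

instance : IsProbabilityMeasure (stdGaussianPi ι) := by
  unfold stdGaussianPi; infer_instance

theorem integrable_eval_stdGaussianPi (i : ι) :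
    Integrable (fun w : ι → ℝ => w i) (stdGaussianPi ι) :=
  (measurePreserving_eval (fun _ : ι => gaussianReal 0 1) i).integrable_comp_of_integrable
    integrable_id_gaussianReal_std

/-- Gaussian integration by parts in one coordinate. -/
theorem integral_eval_mul_stdGaussianPi [DecidableEq ι] {f f' : (ι → ℝ) → ℝ} {C : ℝ} (i : ι)
    (hfm : Measurable f) (hf'm : Measurable f')
    (hf : ∀ w y, HasDerivAt (fun y => f (Function.update w i y)) (f' (Function.update w i y)) y)
    (hb : ∀ w, |f w| ≤ C) (hb' : ∀ w, |f' w| ≤ C) :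
    ∫ w, w i * f w ∂(stdGaussianPi ι) = ∫ w, f' w ∂(stdGaussianPi ι) := by
  have hmp := measurePreserving_update_pi (fun _ : ι => gaussianReal 0 1) i
  have hfi : Integrable (fun w : ι → ℝ => w i * f w) (stdGaussianPi ι) :=
    (integrable_eval_stdGaussianPi i).mul_bdd hfm.aestronglyMeasurable (ae_of_all _ hb)
  have hfi' : Integrable f' (stdGaussianPi ι) :=
    Integrable.of_bound hf'm.aestronglyMeasurable C (ae_of_all _ hb')
  have h1 : ∀ g : (ι → ℝ) → ℝ, Integrable g (stdGaussianPi ι) →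
      ∫ w, g w ∂(stdGaussianPi ι) = ∫ w, ∫ y, g (Function.update w i y)
        ∂(gaussianReal 0 1) ∂(stdGaussianPi ι) := by
    intro g hg
    have hg' := hmp.integrable_comp_of_integrable hg
    refine Eq.trans ?_ (integral_prod _ hg')
    conv_lhs => rw [stdGaussianPi, ← hmp.map_eq]
    rw [integral_map hmp.measurable.aemeasurable]
    · rfl
    · rw [hmp.map_eq]; exact hg.aestronglyMeasurable
  rw [h1 _ hfi, h1 _ hfi']
  congr 1
  ext w
  simp only [Function.update_self]
  exact integral_mul_gaussianReal_std (hf w) (hf'm.comp (measurable_update w))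
    (fun y => hb _) (fun y => hb' _)

theorem integral_exp_sum_stdGaussianPi (a : ι → ℝ) :
    Integrable (fun w : ι → ℝ => exp (∑ i, a i * w i)) (stdGaussianPi ι) ∧
    ∫ w, exp (∑ i, a i * w i) ∂(stdGaussianPi ι) = exp ((∑ i, a i ^ 2) / 2) := by
  simp only [exp_sum]
  refine ⟨Integrable.fintype_prod fun i => integrable_exp_mul_gaussianReal (a i), ?_⟩
  rw [stdGaussianPi, integral_fintype_prod_eq_prod (fun i x => exp (a i * x)), Finset.sum_div,
    exp_sum]
  refine Finset.prod_congr rfl fun i _ => ?_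
  have := mgf_gaussianReal (p := gaussianReal 0 1) (X := id) (μ := 0) (v := 1) (by simp) (a i)
  simpa [mgf] using this

end Pi

section SoftMax

variable {S : Type*} [Fintype S]

/-- The smooth maximum `log ∑ exp`. -/
noncomputable def logSumExp (x : S → ℝ) : ℝ := log (∑ s, exp (x s))

/-- The Gibbs weights, which form the gradient of `logSumExp`. -/
noncomputable def gibbsWeight (x : S → ℝ) (s : S) : ℝ := exp (x s) / ∑ t, exp (x t)

theorem gibbsWeight_nonneg (x : S → ℝ) (s : S) : 0 ≤ gibbsWeight x s := by
  unfold gibbsWeight; positivity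

variable [Nonempty S]

theorem sum_exp_pos (x : S → ℝ) : 0 < ∑ s, exp (x s) :=
  Finset.sum_pos (fun _ _ => exp_pos _) Finset.univ_nonempty

theorem sum_gibbsWeight (x : S → ℝ) : ∑ s, gibbsWeight x s = 1 := by
  simp only [gibbsWeight, ← Finset.sum_div]
  exact div_self (sum_exp_pos x).ne'

theorem gibbsWeight_le_one (x : S → ℝ) (s : S) : gibbsWeight x s ≤ 1 := by
  rw [← sum_gibbsWeight x]
  exact Finset.single_le_sum (fun t _ => gibbsWeight_nonneg x t) (Finset.mem_univ s)

theorem abs_gibbsWeight_le_one (x : S → ℝ) (s : S) : |gibbsWeight x s| ≤ 1 := by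
  rw [abs_of_nonneg (gibbsWeight_nonneg x s)]
  exact gibbsWeight_le_one x s

theorem continuous_logSumExp : Continuous (logSumExp : (S → ℝ) → ℝ) := by
  unfold logSumExp
  exact Continuous.log (by fun_prop) fun x => (sum_exp_pos x).ne'

theorem continuous_gibbsWeight (s : S) : Continuous fun x : S → ℝ => gibbsWeight x s := by
  unfold gibbsWeight
  exact Continuous.div (by fun_prop) (by fun_prop) fun x => (sum_exp_pos x).ne'

theorem hasDerivAt_logSumExp {x : ℝ → S → ℝ} {x' : S → ℝ} {t : ℝ}
    (hx : ∀ s, HasDerivAt (fun t => x t s) (x' s) t) :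
    HasDerivAt (fun t => logSumExp (x t)) (∑ s, gibbsWeight (x t) s * x' s) t := by
  have h := (HasDerivAt.fun_sum (u := Finset.univ) fun s _ => (hx s).exp).log
    (sum_exp_pos (x t)).ne'
  refine h.congr_deriv ?_
  rw [Finset.sum_div]
  refine Finset.sum_congr rfl fun s _ => ?_
  rw [gibbsWeight]
  ring

theorem hasDerivAt_gibbsWeight {x : ℝ → S → ℝ} {x' : S → ℝ} {t : ℝ}
    (hx : ∀ s, HasDerivAt (fun t => x t s) (x' s) t) (s : S) :
    HasDerivAt (fun t => gibbsWeight (x t) s)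
      (gibbsWeight (x t) s * (x' s - ∑ r, gibbsWeight (x t) r * x' r)) t := by
  have hZ := sum_exp_pos (x t)
  have h := (hx s).exp.div (HasDerivAt.fun_sum (u := Finset.univ) fun s _ => (hx s).exp) hZ.ne'
  refine h.congr_deriv ?_
  have : ∑ r, gibbsWeight (x t) r * x' r
      = (∑ r, exp (x t r) * x' r) / ∑ r, exp (x t r) := by
    rw [Finset.sum_div]
    refine Finset.sum_congr rfl fun r _ => ?_
    rw [gibbsWeight]
    ring
  rw [this, gibbsWeight]
  field_simp

theorem le_logSumExp (x : S → ℝ) (s : S) : x s ≤ logSumExp x := by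
  rw [logSumExp, le_log_iff_exp_le (sum_exp_pos x)]
  exact Finset.single_le_sum (f := fun s => exp (x s)) (fun _ _ => (exp_pos _).le)
    (Finset.mem_univ s)

theorem iSup_le_logSumExp (x : S → ℝ) : ⨆ s, x s ≤ logSumExp x :=
  ciSup_le fun s => le_logSumExp x s

theorem logSumExp_le_iSup_add (x : S → ℝ) :
    logSumExp x ≤ (⨆ s, x s) + log (Fintype.card S) := by
  have hc : (0 : ℝ) < Fintype.card S := by exact_mod_cast Fintype.card_pos
  rw [logSumExp, log_le_iff_le_exp (sum_exp_pos x), exp_add, exp_log hc]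
  calc ∑ s, exp (x s) ≤ ∑ _s : S, exp (⨆ s, x s) :=
        Finset.sum_le_sum fun s _ => exp_le_exp.2 (le_ciSup (Set.finite_range x).bddAbove s)
    _ = exp (⨆ s, x s) * Fintype.card S := by
        rw [Finset.sum_const, Finset.card_univ, nsmul_eq_mul, mul_comm]

theorem abs_iSup_le_sum (x : S → ℝ) : |⨆ s, x s| ≤ ∑ s, |x s| := by
  have hs : ∀ s, |x s| ≤ ∑ s, |x s| := fun s =>
    Finset.single_le_sum (f := fun s => |x s|) (fun _ _ => abs_nonneg _) (Finset.mem_univ s)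
  obtain ⟨s₀⟩ := ‹Nonempty S›
  refine abs_le.2 ⟨?_, ciSup_le fun s => (le_abs_self _).trans (hs s)⟩
  calc -∑ s, |x s| ≤ x s₀ := by linarith [hs s₀, neg_abs_le (x s₀)]
    _ ≤ _ := le_ciSup (Set.finite_range x).bddAbove s₀

theorem abs_logSumExp_le (x : S → ℝ) :
    |logSumExp x| ≤ (∑ s, |x s|) + log (Fintype.card S) := by
  have h := abs_le.1 (abs_iSup_le_sum x)
  have hc : 0 ≤ log (Fintype.card S) := log_natCast_nonneg _
  exact abs_le.2 ⟨by linarith [iSup_le_logSumExp x], by linarith [logSumExp_le_iSup_add x]⟩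

end SoftMax

section Comparison

variable {S ι : Type*} [Fintype ι]

/-- The linear Gaussian process with coefficient vectors `v`. -/
def linProc (v : S → ι → ℝ) (w : ι → ℝ) (s : S) : ℝ := ∑ i, v s i * w i

theorem continuous_linProc (v : S → ι → ℝ) : Continuous (linProc v) := by
  unfold linProc; fun_prop

theorem linProc_smul (c : ℝ) (v : S → ι → ℝ) (w : ι → ℝ) :
    linProc (fun s i => c * v s i) w = fun s => c * linProc v w s := by
  ext s
  simp only [linProc, Finset.mul_sum, mul_assoc]

theorem integrable_linProc (v : S → ι → ℝ) (s : S) :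
    Integrable (fun w => linProc v w s) (stdGaussianPi ι) :=
  integrable_finsetSum _ fun i _ => (integrable_eval_stdGaussianPi i).const_mul _

theorem hasDerivAt_linProc_update [DecidableEq ι] (v : S → ι → ℝ) (w : ι → ℝ) (i : ι) (y : ℝ)
    (s : S) : HasDerivAt (fun y => linProc v (Function.update w i y) s) (v s i) y := by
  have : (fun y => linProc v (Function.update w i y) s)
      = fun y => v s i * y + ∑ j ∈ Finset.univ.erase i, v s j * w j := by
    ext y
    rw [linProc, ← Finset.add_sum_erase _ _ (Finset.mem_univ i), Function.update_self]
    congr 1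
    refine Finset.sum_congr rfl fun j hj => ?_
    rw [Function.update_of_ne (Finset.ne_of_mem_erase hj)]
  rw [this]
  exact ((((hasDerivAt_id y).const_mul (v s i)).add_const _).congr_deriv (mul_one _))

variable [Fintype S] [Nonempty S]

theorem integrable_logSumExp_linProc (v : S → ι → ℝ) :
    Integrable (fun w => logSumExp (linProc v w)) (stdGaussianPi ι) := by
  refine Integrable.mono' (g := fun w => (∑ s, |linProc v w s|) + log (Fintype.card S))
    ((integrable_finsetSum _ fun s _ => (integrable_linProc v s).abs).add (integrable_const _))
    (continuous_logSumExp.comp (continuous_linProc v)).aestronglyMeasurable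
    (ae_of_all _ fun w => abs_logSumExp_le _)

theorem integrable_iSup_linProc (v : S → ι → ℝ) :
    Integrable (fun w => ⨆ s, linProc v w s) (stdGaussianPi ι) := by
  refine Integrable.mono' (g := fun w => ∑ s, |linProc v w s|)
    (integrable_finsetSum _ fun s _ => (integrable_linProc v s).abs)
    (Measurable.iSup fun s => ?_).aestronglyMeasurable
    (ae_of_all _ fun w => abs_iSup_le_sum _)
  exact (measurable_pi_apply s).comp (continuous_linProc v).measurable

theorem integral_eval_mul_gibbsWeight (v : S → ι → ℝ) (s : S) (i : ι) :
    ∫ w, w i * gibbsWeight (linProc v w) s ∂(stdGaussianPi ι)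
      = ∫ w, gibbsWeight (linProc v w) s *
          (v s i - ∑ r, gibbsWeight (linProc v w) r * v r i) ∂(stdGaussianPi ι) := by
  classical
  have hc : ∀ s, Continuous fun w => gibbsWeight (linProc v w) s := fun s =>
    (continuous_gibbsWeight s).comp (continuous_linProc v)
  have hv : ∀ r, |v r i| ≤ ∑ r, |v r i| := fun r =>
    Finset.single_le_sum (f := fun r => |v r i|) (fun _ _ => abs_nonneg _) (Finset.mem_univ r)
  have hsum : ∀ w, |∑ r, gibbsWeight (linProc v w) r * v r i| ≤ ∑ r, |v r i| := fun w =>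
    (Finset.abs_sum_le_sum_abs _ _).trans <| Finset.sum_le_sum fun r _ => by
      rw [abs_mul]
      exact mul_le_of_le_one_left (abs_nonneg _) (abs_gibbsWeight_le_one _ r)
  have h0 : 0 ≤ ∑ r, |v r i| := Finset.sum_nonneg fun _ _ => abs_nonneg _
  refine integral_eval_mul_stdGaussianPi (C := 1 + 2 * ∑ r, |v r i|) i (hc s).measurable
    (Continuous.measurable ?_) (fun w y => ?_) (fun w => ?_) (fun w => ?_)
  · exact (hc s).mul (continuous_const.sub
      (continuous_finsetSum _ fun r _ => (hc r).mul continuous_const))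
  · exact hasDerivAt_gibbsWeight (x := fun y => linProc v (Function.update w i y))
      (hasDerivAt_linProc_update v w i y) s
  · linarith [abs_gibbsWeight_le_one (linProc v w) s]
  · rw [abs_mul]
    refine (mul_le_of_le_one_left (abs_nonneg _) (abs_gibbsWeight_le_one _ s)).trans ?_
    refine (abs_sub _ _).trans ?_
    linarith [hv s, hsum w]

theorem integral_sum_gibbsWeight_mul_linProc (v u : S → ι → ℝ) :
    ∫ w, ∑ s, gibbsWeight (linProc v w) s * linProc u w s ∂(stdGaussianPi ι)
      = ∫ w, ∑ s, gibbsWeight (linProc v w) s * (∑ i, u s i * v s i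
          - ∑ r, gibbsWeight (linProc v w) r * ∑ i, u s i * v r i) ∂(stdGaussianPi ι) := by
  have hc : ∀ s, Continuous fun w => gibbsWeight (linProc v w) s := fun s =>
    (continuous_gibbsWeight s).comp (continuous_linProc v)
  have hp : ∀ s, Integrable (fun w => gibbsWeight (linProc v w) s) (stdGaussianPi ι) := fun s =>
    Integrable.of_bound (hc s).aestronglyMeasurable 1
      (ae_of_all _ fun w => abs_gibbsWeight_le_one _ s)
  have h1 : ∀ s i, Integrable (fun w => u s i * (w i * gibbsWeight (linProc v w) s))
      (stdGaussianPi ι) := fun s i =>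
    ((integrable_eval_stdGaussianPi i).mul_bdd (hc s).aestronglyMeasurable
      (ae_of_all _ fun w => abs_gibbsWeight_le_one _ s)).const_mul _
  have h2 : ∀ s i, Integrable (fun w => u s i * (gibbsWeight (linProc v w) s *
      (v s i - ∑ r, gibbsWeight (linProc v w) r * v r i))) (stdGaussianPi ι) := fun s i =>
    (((integrable_const _).sub (integrable_finsetSum _ fun r _ => (hp r).mul_const _)).bdd_mul
      (hc s).aestronglyMeasurable (ae_of_all _ fun w => abs_gibbsWeight_le_one _ s)).const_mul _
  calc ∫ w, ∑ s, gibbsWeight (linProc v w) s * linProc u w s ∂(stdGaussianPi ι)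
      = ∫ w, ∑ s, ∑ i, u s i * (w i * gibbsWeight (linProc v w) s) ∂(stdGaussianPi ι) := by
        congr 1 with w
        refine Finset.sum_congr rfl fun s _ => ?_
        rw [linProc, Finset.mul_sum]
        exact Finset.sum_congr rfl fun i _ => by ring
    _ = ∑ s, ∑ i, u s i * ∫ w, w i * gibbsWeight (linProc v w) s ∂(stdGaussianPi ι) := by
        rw [integral_finsetSum _ fun s _ => integrable_finsetSum _ fun i _ => h1 s i]
        refine Finset.sum_congr rfl fun s _ => ?_
        rw [integral_finsetSum _ fun i _ => h1 s i]
        exact Finset.sum_congr rfl fun i _ => integral_const_mul _ _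
    _ = ∫ w, ∑ s, ∑ i, u s i * (gibbsWeight (linProc v w) s *
          (v s i - ∑ r, gibbsWeight (linProc v w) r * v r i)) ∂(stdGaussianPi ι) := by
        rw [integral_finsetSum _ fun s _ => integrable_finsetSum _ fun i _ => h2 s i]
        refine Finset.sum_congr rfl fun s _ => ?_
        rw [integral_finsetSum _ fun i _ => h2 s i]
        refine Finset.sum_congr rfl fun i _ => ?_
        rw [integral_const_mul, integral_eval_mul_gibbsWeight]
    _ = _ := by
        congr 1 with w
        refine Finset.sum_congr rfl fun s _ => ?_
        simp only [Finset.mul_sum, mul_sub, Finset.sum_sub_distrib]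
        rw [Finset.sum_comm (s := Finset.univ (α := S))]
        congr 1
        · exact Finset.sum_congr rfl fun i _ => by ring
        · exact Finset.sum_congr rfl fun i _ => Finset.sum_congr rfl fun r _ => by ring

/-- Slepian-type comparison: with equal variances, decreasing the covariances increases the
expected smooth maximum. -/
theorem integral_logSumExp_linProc_le {a b : S → ι → ℝ}
    (horth : ∀ s r, ∑ i, a s i * b r i = 0)
    (hdiag : ∀ s, ∑ i, a s i * a s i = ∑ i, b s i * b s i)
    (hle : ∀ s r, ∑ i, b s i * b r i ≤ ∑ i, a s i * a r i) :
    ∫ w, logSumExp (linProc a w) ∂(stdGaussianPi ι)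
      ≤ ∫ w, logSumExp (linProc b w) ∂(stdGaussianPi ι) := by
  set v : ℝ → S → ι → ℝ := fun θ s i => cos θ * a s i + sin θ * b s i with hv
  set u : ℝ → S → ι → ℝ := fun θ s i => -sin θ * a s i + cos θ * b s i with hu
  have hvu : ∀ w s θ, HasDerivAt (fun θ => linProc (v θ) w s) (linProc (u θ) w s) θ := by
    intro w s θ
    refine HasDerivAt.fun_sum fun i _ => ?_
    exact (((hasDerivAt_cos θ).mul_const _).add ((hasDerivAt_sin θ).mul_const _)).mul_const _
  have hcu : ∀ θ, Continuous fun w =>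
      ∑ s, gibbsWeight (linProc (v θ) w) s * linProc (u θ) w s := fun θ =>
    continuous_finsetSum _ fun s _ =>
      ((continuous_gibbsWeight s).comp (continuous_linProc _)).mul
        ((continuous_apply s).comp (continuous_linProc _))
  have hderiv : ∀ θ, HasDerivAt (fun θ => ∫ w, logSumExp (linProc (v θ) w) ∂(stdGaussianPi ι))
      (∫ w, ∑ s, gibbsWeight (linProc (v θ) w) s * linProc (u θ) w s ∂(stdGaussianPi ι)) θ := by
    intro θ
    refine (hasDerivAt_integral_of_dominated_loc_of_deriv_le
      (F := fun θ w => logSumExp (linProc (v θ) w))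
      (F' := fun θ w => ∑ s, gibbsWeight (linProc (v θ) w) s * linProc (u θ) w s)
      (bound := fun w => ∑ s, ∑ i, (|a s i| + |b s i|) * |w i|)
      univ_mem
      (Eventually.of_forall fun θ => (integrable_logSumExp_linProc _).aestronglyMeasurable)
      (integrable_logSumExp_linProc _) (hcu θ).aestronglyMeasurable
      (ae_of_all _ fun w θ _ => ?_)
      (integrable_finsetSum _ fun s _ => integrable_finsetSum _ fun i _ =>
        (integrable_eval_stdGaussianPi i).abs.const_mul _)
      (ae_of_all _ fun w θ _ => hasDerivAt_logSumExp fun s => hvu w s θ)).2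
    refine (Finset.abs_sum_le_sum_abs _ _).trans (Finset.sum_le_sum fun s _ => ?_)
    rw [abs_mul]
    refine (mul_le_of_le_one_left (abs_nonneg _) (abs_gibbsWeight_le_one _ s)).trans ?_
    refine (Finset.abs_sum_le_sum_abs _ _).trans (Finset.sum_le_sum fun i _ => ?_)
    rw [abs_mul]
    refine mul_le_mul_of_nonneg_right ((abs_add_le _ _).trans ?_) (abs_nonneg _)
    rw [abs_mul, abs_mul, abs_neg]
    exact add_le_add (mul_le_of_le_one_left (abs_nonneg _) (abs_sin_le_one θ))
      (mul_le_of_le_one_left (abs_nonneg _) (abs_cos_le_one θ))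
  have hgram : ∀ θ s r, ∑ i, u θ s i * v θ r i
      = -(sin θ * cos θ * (∑ i, a s i * a r i - ∑ i, b s i * b r i)) := by
    intro θ s r
    have : ∀ i, u θ s i * v θ r i = cos θ * cos θ * (a r i * b s i)
        - sin θ * sin θ * (a s i * b r i)
        - sin θ * cos θ * (a s i * a r i) + sin θ * cos θ * (b s i * b r i) := fun i => by
      simp only [hv, hu]; ring
    simp only [this, Finset.sum_add_distrib, Finset.sum_sub_distrib, ← Finset.mul_sum, horth]
    ring
  have hmono : MonotoneOn (fun θ => ∫ w, logSumExp (linProc (v θ) w) ∂(stdGaussianPi ι))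
      (Set.Icc 0 (π / 2)) := by
    refine monotoneOn_of_deriv_nonneg (convex_Icc _ _)
      (fun θ _ => (hderiv θ).continuousAt.continuousWithinAt)
      (fun θ _ => (hderiv θ).differentiableAt.differentiableWithinAt) fun θ hθ => ?_
    rw [interior_Icc] at hθ
    have hsc : 0 ≤ sin θ * cos θ :=
      mul_nonneg (sin_nonneg_of_nonneg_of_le_pi hθ.1.le (by linarith [hθ.2, pi_pos]))
        (cos_nonneg_of_neg_pi_div_two_le_of_le (by linarith [hθ.1, pi_pos]) hθ.2.le)
    rw [(hderiv θ).deriv, integral_sum_gibbsWeight_mul_linProc]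
    refine integral_nonneg fun w => Finset.sum_nonneg fun s _ =>
      mul_nonneg (gibbsWeight_nonneg _ s) ?_
    simp only [hgram, hdiag, sub_self, mul_zero, neg_zero, zero_sub, mul_neg,
      Finset.sum_neg_distrib, neg_neg]
    exact Finset.sum_nonneg fun r _ => mul_nonneg (gibbsWeight_nonneg _ r)
      (mul_nonneg hsc (sub_nonneg.2 (hle s r)))
  have h := hmono (Set.left_mem_Icc.2 (by positivity)) (Set.right_mem_Icc.2 (by positivity))
    (show (0 : ℝ) ≤ π / 2 by positivity)
  simpa [hv] using h

/-- Slepian-type comparison of expected maxima. -/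
theorem integral_iSup_linProc_le {a b : S → ι → ℝ}
    (horth : ∀ s r, ∑ i, a s i * b r i = 0)
    (hdiag : ∀ s, ∑ i, a s i * a s i = ∑ i, b s i * b s i)
    (hle : ∀ s r, ∑ i, b s i * b r i ≤ ∑ i, a s i * a r i) :
    ∫ w, ⨆ s, linProc a w s ∂(stdGaussianPi ι)
      ≤ ∫ w, ⨆ s, linProc b w s ∂(stdGaussianPi ι) := by
  set A := ∫ w, ⨆ s, linProc a w s ∂(stdGaussianPi ι)
  set B := ∫ w, ⨆ s, linProc b w s ∂(stdGaussianPi ι)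
  set K := log (Fintype.card S)
  have hβ : ∀ β : ℝ, 0 < β → β * A ≤ β * B + K := by
    intro β hβ
    have hsq : ∀ x y : ι → ℝ, ∑ i, β * x i * (β * y i) = β ^ 2 * ∑ i, x i * y i := fun x y => by
      rw [Finset.mul_sum]
      exact Finset.sum_congr rfl fun i _ => by ring
    have key := integral_logSumExp_linProc_le (a := fun s i => β * a s i)
      (b := fun s i => β * b s i) (fun s r => by rw [hsq, horth, mul_zero])
      (fun s => by rw [hsq, hsq, hdiag])
      (fun s r => by rw [hsq, hsq]; exact mul_le_mul_of_nonneg_left (hle s r) (sq_nonneg β))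
    calc β * A = ∫ w, β * ⨆ s, linProc a w s ∂(stdGaussianPi ι) := (integral_const_mul _ _).symm
      _ ≤ ∫ w, logSumExp (linProc (fun s i => β * a s i) w) ∂(stdGaussianPi ι) := by
          refine integral_mono ((integrable_iSup_linProc a).const_mul β)
            (integrable_logSumExp_linProc _) fun w => ?_
          simp only [linProc_smul]
          rw [Real.mul_iSup_of_nonneg hβ.le]
          exact iSup_le_logSumExp _
      _ ≤ ∫ w, logSumExp (linProc (fun s i => β * b s i) w) ∂(stdGaussianPi ι) := key
      _ ≤ ∫ w, (β * (⨆ s, linProc b w s) + K) ∂(stdGaussianPi ι) := by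
          refine integral_mono (integrable_logSumExp_linProc _)
            (((integrable_iSup_linProc b).const_mul β).add (integrable_const _)) fun w => ?_
          simp only [linProc_smul]
          rw [Real.mul_iSup_of_nonneg hβ.le]
          exact logSumExp_le_iSup_add _
      _ = β * B + K := by
          rw [integral_add ((integrable_iSup_linProc b).const_mul β) (integrable_const _),
            integral_const_mul]
          simp [B]
  by_contra! hlt
  have hK : 0 ≤ K := log_natCast_nonneg _
  have hpos : 0 < A - B := sub_pos.2 hlt
  have h := hβ ((K + 1) / (A - B)) (by positivity)
  have : (K + 1) / (A - B) * (A - B) = K + 1 := div_mul_cancel₀ _ hpos.ne'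
  nlinarith

/-- The expected maximum is at most the logarithm of the expected partition function. -/
theorem integral_iSup_linProc_le_of_variance_le {a : S → ι → ℝ} {V : ℝ}
    (ha : ∀ s, ∑ i, a s i ^ 2 ≤ V) :
    ∫ w, ⨆ s, linProc a w s ∂(stdGaussianPi ι) ≤ log (Fintype.card S) + V / 2 := by
  have hcard : (0 : ℝ) < Fintype.card S := by exact_mod_cast Fintype.card_pos
  set c : ℝ := Fintype.card S * exp (V / 2) with hc
  have hc0 : 0 < c := by positivity
  have hfi : ∀ s, Integrable (fun w => exp (linProc a w s)) (stdGaussianPi ι) := fun s =>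
    (integral_exp_sum_stdGaussianPi (a s)).1
  have hZ : ∫ w, ∑ s, exp (linProc a w s) ∂(stdGaussianPi ι) ≤ c := by
    rw [integral_finsetSum _ fun s _ => hfi s]
    calc ∑ s, ∫ w, exp (linProc a w s) ∂(stdGaussianPi ι) ≤ ∑ _s : S, exp (V / 2) := by
          refine Finset.sum_le_sum fun s _ => ?_
          refine (integral_exp_sum_stdGaussianPi (a s)).2.trans_le (exp_le_exp.2 ?_)
          linarith [ha s]
      _ = c := by rw [Finset.sum_const, Finset.card_univ, nsmul_eq_mul]
  have hlog : log c = log (Fintype.card S) + V / 2 := by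
    rw [hc, log_mul hcard.ne' (exp_pos _).ne', log_exp]
  rw [← hlog]
  have hZi : Integrable (fun w => (∑ s, exp (linProc a w s)) / c) (stdGaussianPi ι) :=
    (integrable_finsetSum _ fun s _ => hfi s).div_const c
  calc ∫ w, ⨆ s, linProc a w s ∂(stdGaussianPi ι)
      ≤ ∫ w, ((∑ s, exp (linProc a w s)) / c + (log c - 1)) ∂(stdGaussianPi ι) := by
        refine integral_mono (integrable_iSup_linProc a) (hZi.add (integrable_const _))
          fun w => (iSup_le_logSumExp _).trans ?_
        have hpos := sum_exp_pos (linProc a w)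
        have := log_le_sub_one_of_pos (div_pos hpos hc0)
        rw [log_div hpos.ne' hc0.ne'] at this
        change log _ ≤ _
        linarith
    _ = (∫ w, ∑ s, exp (linProc a w s) ∂(stdGaussianPi ι)) / c + (log c - 1) := by
        rw [integral_add hZi (integrable_const _), integral_div]
        simp
    _ ≤ 1 + (log c - 1) := by gcongr; exact (div_le_one hc0).2 hZ
    _ = log c := by ring

end Comparison

section SherringtonKirkpatrick

/-- Spin configurations. -/
abbrev Spin (N : ℕ) : Type := Fin N → ({-1, 1} : Finset ℝ)

instance (N : ℕ) : Nonempty (Spin N) := ⟨fun _ => ⟨1, by simp⟩⟩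

/-- The coefficients of the Gaussian variables in the Sherrington–Kirkpatrick Hamiltonian. -/
noncomputable def skCoeff (N : ℕ) (σ : Spin N) (p : Fin N × Fin N) : ℝ :=
  1 / √N * (σ p.1 * σ p.2)

/-- The expected ground-state energy. -/
noncomputable def groundEnergy (N : ℕ) : ℝ :=
  ∫ W, ⨆ σ, linProc (skCoeff N) W σ ∂(stdGaussianPi (Fin N × Fin N))

theorem HSK_eq_linProc (N : ℕ) (W : Fin N × Fin N → ℝ) (σ : Spin N) :
    HSK N W (fun i => (σ i : ℝ)) = linProc (skCoeff N) W σ := by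
  simp only [HSK, linProc, skCoeff, Fintype.sum_prod_type, Finset.mul_sum]
  exact Finset.sum_congr rfl fun i _ => Finset.sum_congr rfl fun j _ => by ring

theorem sum_skCoeff_mul (N : ℕ) (σ τ : Spin N) :
    ∑ p, skCoeff N σ p * skCoeff N τ p = (∑ i, (σ i : ℝ) * τ i) ^ 2 / N := by
  have h : (1 / √(N : ℝ)) * (1 / √(N : ℝ)) = 1 / N := by
    rw [div_mul_div_comm, one_mul, mul_self_sqrt (Nat.cast_nonneg N)]
  rw [sq, Finset.sum_mul_sum, ← Fintype.sum_prod_type', Finset.sum_div]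
  refine Finset.sum_congr rfl fun p _ => ?_
  rw [skCoeff, skCoeff, div_eq_mul_one_div _ (N : ℝ), ← h]
  ring

theorem spin_mul_self {N : ℕ} (σ : Spin N) (i : Fin N) : (σ i : ℝ) * σ i = 1 := by
  have := (σ i).2
  simp only [Finset.mem_insert, Finset.mem_singleton] at this
  rcases this with h | h <;> rw [h] <;> norm_num

theorem sum_skCoeff_mul_self (N : ℕ) (σ : Spin N) :
    ∑ p, skCoeff N σ p * skCoeff N σ p = N := by
  simp [sum_skCoeff_mul, spin_mul_self, sq]

theorem integral_iSup_linProc_precomp {S ι κ : Type*} [Fintype S] [Fintype ι] [Fintype κ]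
    [Nonempty S] (v : S → κ → ℝ) {e : κ → ι} (he : e.Injective) :
    Integrable (fun w : ι → ℝ => ⨆ s, linProc v (fun k => w (e k)) s) (stdGaussianPi ι) ∧
    ∫ w : ι → ℝ, ⨆ s, linProc v (fun k => w (e k)) s ∂(stdGaussianPi ι)
      = ∫ w, ⨆ s, linProc v w s ∂(stdGaussianPi κ) := by
  have hmp : MeasurePreserving (fun (w : ι → ℝ) k => w (e k)) (stdGaussianPi ι)
    (stdGaussianPi κ) := measurePreserving_precomp_pi _ he
  refine ⟨hmp.integrable_comp_of_integrable (integrable_iSup_linProc v), ?_⟩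
  rw [← hmp.map_eq, integral_map hmp.measurable.aemeasurable]
  rw [hmp.map_eq]
  exact (integrable_iSup_linProc v).aestronglyMeasurable

theorem add_sq_div_add_le {x y m n : ℝ} (hm : 0 ≤ m) (hn : 0 ≤ n) (hx : m = 0 → x = 0)
    (hy : n = 0 → y = 0) : (x + y) ^ 2 / (m + n) ≤ x ^ 2 / m + y ^ 2 / n := by
  rcases hm.eq_or_lt with rfl | hm
  · simp [hx rfl]
  rcases hn.eq_or_lt with rfl | hn
  · simp [hy rfl]
  rw [div_add_div _ _ hm.ne' hn.ne', div_le_div_iff₀ (by positivity) (by positivity)]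
  nlinarith [mul_nonneg (add_pos hm hn).le (sq_nonneg (n * x - m * y)),
    sq_nonneg (n * x - m * y)]

theorem groundEnergy_add_le (m n : ℕ) :
    groundEnergy m + groundEnergy n ≤ groundEnergy (m + n) := by
  let ι := (Fin (m + n) × Fin (m + n)) ⊕ ((Fin m × Fin m) ⊕ (Fin n × Fin n))
  let l (σ : Spin (m + n)) : Spin m := fun i => σ (Fin.castAdd n i)
  let r (σ : Spin (m + n)) : Spin n := fun i => σ (Fin.natAdd m i)
  let a : Spin (m + n) → ι → ℝ := fun σ =>
    Sum.elim 0 (Sum.elim (skCoeff m (l σ)) (skCoeff n (r σ)))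
  let b : Spin (m + n) → ι → ℝ := fun σ => Sum.elim (skCoeff (m + n) σ) 0
  have haa : ∀ σ τ, ∑ i, a σ i * a τ i = (∑ i, (l σ i : ℝ) * l τ i) ^ 2 / m
      + (∑ i, (r σ i : ℝ) * r τ i) ^ 2 / n := fun σ τ => by
    simp [a, ι, Fintype.sum_sum_type, sum_skCoeff_mul]
  have hbb : ∀ σ τ, ∑ i, b σ i * b τ i = (∑ i, (l σ i : ℝ) * l τ i
      + ∑ i, (r σ i : ℝ) * r τ i) ^ 2 / (m + n) := fun σ τ => by
    simp [b, ι, l, r, Fintype.sum_sum_type, sum_skCoeff_mul, Fin.sum_univ_add]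
  have key := integral_iSup_linProc_le (a := a) (b := b)
    (fun σ τ => by simp [a, b, ι, Fintype.sum_sum_type])
    (fun σ => by
      simp [a, b, ι, Fintype.sum_sum_type, sum_skCoeff_mul_self])
    (fun σ τ => by
      rw [haa, hbb]
      refine add_sq_div_add_le m.cast_nonneg n.cast_nonneg (fun h => ?_) (fun h => ?_)
      · obtain rfl : m = 0 := by exact_mod_cast h
        simp
      · obtain rfl : n = 0 := by exact_mod_cast h
        simp)
  let em : Fin m × Fin m → ι := fun p => Sum.inr (Sum.inl p)
  let en : Fin n × Fin n → ι := fun p => Sum.inr (Sum.inr p)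
  let eb : Fin (m + n) × Fin (m + n) → ι := Sum.inl
  obtain ⟨him, hm⟩ := integral_iSup_linProc_precomp (skCoeff m) (e := em)
    (Sum.inr_injective.comp Sum.inl_injective)
  obtain ⟨hin, hn⟩ := integral_iSup_linProc_precomp (skCoeff n) (e := en)
    (Sum.inr_injective.comp Sum.inr_injective)
  obtain ⟨-, hb⟩ := integral_iSup_linProc_precomp (skCoeff (m + n)) (e := eb) Sum.inl_injective
  have hb' : ∀ w : ι → ℝ, linProc b w = linProc (skCoeff (m + n)) fun k => w (eb k) := fun w => by
    ext σ
    simp [linProc, b, eb, ι, Fintype.sum_sum_type]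
  have ha' : ∀ (w : ι → ℝ) σ, linProc a w σ = linProc (skCoeff m) (fun k => w (em k)) (l σ)
      + linProc (skCoeff n) (fun k => w (en k)) (r σ) := fun w σ => by
    simp [linProc, a, em, en, ι, Fintype.sum_sum_type]
  rw [groundEnergy, groundEnergy, groundEnergy, ← hm, ← hn, ← hb, ← integral_add him hin]
  simp only [hb'] at key
  refine le_trans (integral_mono (him.add hin) (integrable_iSup_linProc a) fun w => ?_) key
  obtain ⟨σ₁, h₁⟩ := exists_eq_ciSup_of_finite (f := linProc (skCoeff m) fun k => w (em k))
  obtain ⟨σ₂, h₂⟩ := exists_eq_ciSup_of_finite (f := linProc (skCoeff n) fun k => w (en k))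
  have hl : l (Fin.append σ₁ σ₂) = σ₁ := by ext i; simp [l]
  have hr : r (Fin.append σ₁ σ₂) = σ₂ := by ext i; simp [r]
  calc _ = linProc a w (Fin.append σ₁ σ₂) := by rw [ha', hl, hr, h₁, h₂]
    _ ≤ _ := le_ciSup (Set.finite_range _).bddAbove _

theorem groundEnergy_le (N : ℕ) : groundEnergy N ≤ N * (log 2 + 1 / 2) := by
  have h := integral_iSup_linProc_le_of_variance_le (a := skCoeff N) (V := N) fun σ => by
    simp only [sq, sum_skCoeff_mul_self, le_refl]
  have hcard : Fintype.card (Spin N) = 2 ^ N := by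
    rw [Fintype.card_fun, Fintype.card_coe, Fintype.card_fin, Finset.card_pair (by norm_num)]
  rw [hcard] at h
  push_cast at h
  rw [log_pow] at h
  refine h.trans_eq ?_
  ring

end SherringtonKirkpatrick

/-- The normalized expected ground-state energy `N^{-1} E[max_{σ ∈ {-1,1}^N} H_N(σ)]`
of the Sherrington–Kirkpatrick model converges as `N → ∞`. -/
theorem sk_ground_state_energy_converges :
    ∃ L : ℝ, Tendsto (fun N : ℕ =>
      (1 / (N : ℝ)) *
        ∫ W, (⨆ σ : Fin N → ({-1, 1} : Finset ℝ), HSK N W fun i => (σ i : ℝ)) ∂(gaussW N))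
      atTop (nhds L) := by
  have hsub : Subadditive fun N => -groundEnergy N := fun m n => by
    linarith [groundEnergy_add_le m n]
  have hbdd : BddBelow (Set.range fun N : ℕ => -groundEnergy N / N) := by
    refine ⟨-(log 2 + 1 / 2), ?_⟩
    rintro _ ⟨N, rfl⟩
    have h2 : 0 ≤ log 2 + 1 / 2 := by positivity
    rcases N.eq_zero_or_pos with rfl | hN
    · simp only [Nat.cast_zero, div_zero]
      exact neg_nonpos.2 h2
    · have hN' : (0 : ℝ) < N := by exact_mod_cast hN
      change _ ≤ _ / _
      rw [le_div_iff₀ hN']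
      linarith [groundEnergy_le N]
  refine ⟨-hsub.lim, (hsub.tendsto_lim hbdd).neg.congr fun N => ?_⟩
  simp only [HSK_eq_linProc]
  change -(-groundEnergy N / N) = 1 / (N : ℝ) * groundEnergy N
  ring
end

section
/- For every N ≥ 1, one has E[max_{σ∈{-1,1}^N} H_N(σ)] ≤ N √(2 log 2). -/
open MeasureTheory ProbabilityTheory Real Filter
open scoped NNReal

/-- The exponential-moment bound for the expectation of the maximum of finitely many
random variables. -/
theorem integral_iSup_le_log_card_mul_div {Ω ι : Type*} [MeasurableSpace Ω] [Fintype ι]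
    [Nonempty ι] {μ : Measure Ω} [IsProbabilityMeasure μ] {X : ι → Ω → ℝ} {t M : ℝ}
    (ht : 0 < t) (hM : 1 ≤ M) (hint : ∀ i, Integrable (fun ω => Real.exp (t * X i ω)) μ)
    (hmgf : ∀ i, mgf (X i) μ t ≤ M) :
    ∫ ω, (⨆ i, X i ω) ∂μ ≤ Real.log (Fintype.card ι * M) / t := by
  have hcard : (1 : ℝ) ≤ Fintype.card ι := by exact_mod_cast Fintype.card_pos
  have hK : 1 ≤ Fintype.card ι * M := one_le_mul_of_one_le_of_one_le hcard hM
  set K := Fintype.card ι * M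
  have hKpos : 0 < K := by linarith
  by_cases hsup : Integrable (fun ω => ⨆ i, X i ω) μ
  swap
  · rw [integral_undef hsup]
    exact div_nonneg (Real.log_nonneg hK) ht.le
  rw [le_div_iff₀ ht]
  have hsum : Integrable (fun ω => ∑ i, Real.exp (t * X i ω)) μ :=
    integrable_finsetSum _ fun i _ => hint i
  have hpt (ω : Ω) :
      (⨆ i, X i ω) * t ≤ (Real.log K - 1) + K⁻¹ * ∑ i, Real.exp (t * X i ω) := by
    obtain ⟨i, hi⟩ := exists_eq_ciSup_of_finite (f := fun i => X i ω)
    rw [← hi]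
    have hexp : Real.exp (t * X i ω - Real.log K) = K⁻¹ * Real.exp (t * X i ω) := by
      rw [Real.exp_sub, Real.exp_log hKpos]
      ring
    have hle : Real.exp (t * X i ω) ≤ ∑ i, Real.exp (t * X i ω) :=
      Finset.single_le_sum (f := fun i => Real.exp (t * X i ω))
        (fun _ _ => (Real.exp_pos _).le) (Finset.mem_univ i)
    have hmul := mul_le_mul_of_nonneg_left hle (inv_nonneg.2 hKpos.le)
    have hadd := Real.add_one_le_exp (t * X i ω - Real.log K)
    linarith
  calc (∫ ω, (⨆ i, X i ω) ∂μ) * t = ∫ ω, (⨆ i, X i ω) * t ∂μ := (integral_mul_const _ _).symm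
    _ ≤ ∫ ω, ((Real.log K - 1) + K⁻¹ * ∑ i, Real.exp (t * X i ω)) ∂μ :=
        integral_mono (hsup.mul_const t) ((integrable_const _).add (hsum.const_mul _)) hpt
    _ = (Real.log K - 1) + K⁻¹ * ∑ i, mgf (X i) μ t := by
        rw [integral_add (integrable_const _) (hsum.const_mul _), integral_const_mul,
          integral_finsetSum _ fun i _ => hint i]
        simp [mgf]
    _ ≤ (Real.log K - 1) + K⁻¹ * K := by
        gcongr
        calc ∑ i, mgf (X i) μ t ≤ ∑ _i : ι, M := Finset.sum_le_sum fun i _ => hmgf i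
          _ = K := by simp [K]
    _ = Real.log K := by
        rw [inv_mul_cancel₀ hKpos.ne']
        ring

theorem integrable_exp_sum_mul_pi_gaussianReal {κ : Type*} [Fintype κ] (a : κ → ℝ) :
    Integrable (fun W : κ → ℝ => Real.exp (∑ p, a p * W p))
      (Measure.pi fun _ => gaussianReal 0 1) := by
  simp_rw [Real.exp_sum]
  exact Integrable.fintype_prod fun p => integrable_exp_mul_gaussianReal (a p)

theorem integral_exp_sum_mul_pi_gaussianReal {κ : Type*} [Fintype κ] (a : κ → ℝ) :
    ∫ W : κ → ℝ, Real.exp (∑ p, a p * W p) ∂(Measure.pi fun _ => gaussianReal 0 1)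
      = Real.exp ((∑ p, a p ^ 2) / 2) := by
  simp_rw [Real.exp_sum]
  rw [integral_fintype_prod_eq_prod (fun p x => Real.exp (a p * x)), Finset.sum_div,
    Real.exp_sum]
  refine Finset.prod_congr rfl fun p _ => ?_
  have h := congrFun (mgf_id_gaussianReal (μ := 0) (v := 1)) (a p)
  simpa [mgf] using h

theorem mul_HSK_eq_sum (N : ℕ) (W : (Fin N × Fin N) → ℝ) (σ : Fin N → ℝ) (t : ℝ) :
    t * HSK N W σ = ∑ p : Fin N × Fin N, (t * (1 / √N) * σ p.1 * σ p.2) * W p := by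
  rw [HSK, Fintype.sum_prod_type, ← mul_assoc, Finset.mul_sum]
  refine Finset.sum_congr rfl fun i _ => ?_
  rw [Finset.mul_sum]
  exact Finset.sum_congr rfl fun j _ => by ring

theorem integrable_exp_mul_HSK (N : ℕ) (σ : Fin N → ℝ) (t : ℝ) :
    Integrable (fun W => Real.exp (t * HSK N W σ)) (gaussW N) := by
  simp_rw [mul_HSK_eq_sum]
  exact integrable_exp_sum_mul_pi_gaussianReal _

theorem mgf_HSK {N : ℕ} (hN : 1 ≤ N) {σ : Fin N → ℝ} (hσ : ∀ i, σ i ^ 2 = 1) (t : ℝ) :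
    mgf (fun W => HSK N W σ) (gaussW N) t = Real.exp (N * t ^ 2 / 2) := by
  have hN0 : (N : ℝ) ≠ 0 := by exact_mod_cast (by omega : N ≠ 0)
  simp_rw [mgf, mul_HSK_eq_sum, gaussW]
  rw [integral_exp_sum_mul_pi_gaussianReal]
  simp only [mul_pow, hσ, div_pow, Real.sq_sqrt (Nat.cast_nonneg N), Finset.sum_const,
    Finset.card_univ, Fintype.card_prod, Fintype.card_fin, nsmul_eq_mul]
  push_cast
  congr 1
  field_simp

/-- Upper bound on the expected maximum of the SK Hamiltonian:
`E[max_{σ ∈ {-1,1}^N} H_N(σ)] ≤ N √(2 log 2)`. -/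
theorem sk_expected_max_upper_bound (N : ℕ) (hN : 1 ≤ N) :
    (∫ W, (⨆ σ : Fin N → ({-1, 1} : Finset ℝ), HSK N W fun i => (σ i : ℝ)) ∂(gaussW N))
      ≤ N * Real.sqrt (2 * Real.log 2) := by
  have hlog : 0 < 2 * Real.log 2 := by positivity
  have ht : 0 < √(2 * Real.log 2) := Real.sqrt_pos.2 hlog
  have ht2 : √(2 * Real.log 2) ^ 2 = 2 * Real.log 2 := Real.sq_sqrt hlog.le
  set t := √(2 * Real.log 2)
  have : IsProbabilityMeasure (gaussW N) := by
    unfold gaussW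
    infer_instance
  have : Nonempty ({-1, 1} : Finset ℝ) := ⟨⟨1, by simp⟩⟩
  have hσ (σ : Fin N → ({-1, 1} : Finset ℝ)) (i : Fin N) : (σ i : ℝ) ^ 2 = 1 := by
    have h := (σ i).2
    rw [Finset.mem_insert, Finset.mem_singleton] at h
    rcases h with h | h <;> simp [h]
  have hcard : Fintype.card (Fin N → ({-1, 1} : Finset ℝ)) = 2 ^ N := by
    have h2 : ({-1, 1} : Finset ℝ).card = 2 := Finset.card_pair (by norm_num)
    rw [Fintype.card_fun, Fintype.card_coe, h2, Fintype.card_fin]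
  refine (integral_iSup_le_log_card_mul_div ht (M := Real.exp (N * t ^ 2 / 2))
    (Real.one_le_exp (by positivity)) (fun σ => integrable_exp_mul_HSK N _ t)
    (fun σ => (mgf_HSK hN (hσ σ) t).le)).trans ?_
  rw [div_le_iff₀ ht, hcard, Real.log_mul (by positivity) (Real.exp_ne_zero _), Real.log_exp]
  push_cast
  rw [Real.log_pow, mul_assoc, ← sq, ht2]
  exact le_of_eq (by ring)
end
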